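/- For each n ≥ 1 let p_n be a probability measure on the symmetric group S_n that is invariant under conjugation, and assume that for every ε > 0, p_n({σ : #(σ)/√n > ε}) → 0 as n → ∞. Then for every ε > 0, p_n({σ : |ℓ(σ)/√n − 2| > ε}) → 0 and p_n({σ : |ℓ̄(σ)/√n − 2| > ε}) → 0 as n → ∞. -/

import Mathlib

noncomputable section

/-- `s` is (the index set of) an increasing subsequence of `σ`. -/
def IncSeq {n : ℕ} (σ : Equiv.Perm (Fin n)) (s : Finset (Fin n)) : Prop :=
  ∀ i ∈ s, ∀ j ∈ s, i < j → σ i < σ j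

/-- `s` is (the index set of) a decreasing subsequence of `σ`. -/
def DecSeq {n : ℕ} (σ : Equiv.Perm (Fin n)) (s : Finset (Fin n)) : Prop :=
  ∀ i ∈ s, ∀ j ∈ s, i < j → σ j < σ i

/-- ℓ(σ): maximal cardinality of an increasing subsequence of `σ`. -/
def lis {n : ℕ} (σ : Equiv.Perm (Fin n)) : ℕ :=
  sSup {k | ∃ s : Finset (Fin n), IncSeq σ s ∧ s.card = k}

/-- ℓ̄(σ): maximal cardinality of a decreasing subsequence of `σ`. -/
def lds {n : ℕ} (σ : Equiv.Perm (Fin n)) : ℕ :=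
  sSup {k | ∃ s : Finset (Fin n), DecSeq σ s ∧ s.card = k}

/-- #(σ): number of cycles of `σ`, fixed points counted as cycles. -/
def numCycles {n : ℕ} (σ : Equiv.Perm (Fin n)) : ℕ :=
  σ.cycleType.card + (Finset.univ.filter fun x => σ x = x).card

/-- The probability of the event `P` under the probability mass function `p` on `S_n`. -/
def permProb {n : ℕ} (p : Equiv.Perm (Fin n) → ℝ) (P : Equiv.Perm (Fin n) → Prop) : ℝ :=
  ∑ σ, Set.indicator {σ' | P σ'} p σ


def wt (q : ℝ) (b : Bool) : ℝ := if b then q else 1 - q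
def bt (b : Bool) : ℝ := if b then 1 else 0

def Ex {ι : Type} [Fintype ι] [DecidableEq ι] (q : ι → ℝ) (f : (ι → Bool) → ℝ) : ℝ :=
  ∑ x, (∏ i, wt (q i) (x i)) * f x

section
variable {ι : Type} [Fintype ι] [DecidableEq ι] {q : ι → ℝ}

lemma Ex_const (c : ℝ) : Ex q (fun _ => c) = c := by
  unfold Ex
  rw [← Finset.sum_mul]
  have : ∑ x : ι → Bool, ∏ i, wt (q i) (x i) = 1 := by
    rw [← Fintype.piFinset_univ, ← Finset.prod_univ_sum]
    simp [wt]
  rw [this, one_mul]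

lemma Ex_add (f g : (ι → Bool) → ℝ) : Ex q (fun x => f x + g x) = Ex q f + Ex q g := by
  simp [Ex, mul_add, Finset.sum_add_distrib]

lemma Ex_mul (c : ℝ) (f : (ι → Bool) → ℝ) : Ex q (fun x => c * f x) = c * Ex q f := by
  simp only [Ex, Finset.mul_sum]; refine Finset.sum_congr rfl fun x _ => by ring

lemma Ex_div (c : ℝ) (f : (ι → Bool) → ℝ) : Ex q (fun x => f x / c) = Ex q f / c := by
  simp only [Ex, Finset.sum_div]; refine Finset.sum_congr rfl fun x _ => by ring

lemma Ex_sum {κ : Type} (s : Finset κ) (f : κ → (ι → Bool) → ℝ) :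
    Ex q (fun x => ∑ k ∈ s, f k x) = ∑ k ∈ s, Ex q (f k) := by
  simp only [Ex, Finset.mul_sum]; rw [Finset.sum_comm]

lemma Ex_mono (h0 : ∀ i, 0 ≤ q i) (h1 : ∀ i, q i ≤ 1) {f g : (ι → Bool) → ℝ}
    (h : ∀ x, f x ≤ g x) : Ex q f ≤ Ex q g := by
  unfold Ex
  refine Finset.sum_le_sum fun x _ => mul_le_mul_of_nonneg_left (h x) ?_
  refine Finset.prod_nonneg fun i _ => ?_
  unfold wt; split_ifs
  · exact h0 i
  · linarith [h1 i]

lemma Ex_comm {κ : Type} [Fintype κ] [DecidableEq κ] {r : κ → ℝ} (f : (ι → Bool) → (κ → Bool) → ℝ) :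
    Ex q (fun x => Ex r (fun y => f x y)) = Ex r (fun y => Ex q (fun x => f x y)) := by
  simp only [Ex, Finset.mul_sum]; rw [Finset.sum_comm]
  refine Finset.sum_congr rfl fun x _ => Finset.sum_congr rfl fun y _ => by ring

lemma Ex_resample (i : ι) (f : (ι → Bool) → ℝ) :
    Ex q f = Ex q (fun x => q i * f (Function.update x i true)
      + (1 - q i) * f (Function.update x i false)) := by
  rw [← sub_eq_zero]
  unfold Ex
  rw [← Finset.sum_sub_distrib]
  refine Finset.sum_ninvolution (fun x => Function.update x i (! x i)) ?_ ?_ ?_ ?_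
  · intro x
    rw [Finset.prod_eq_mul_prod_sdiff_singleton_of_mem (Finset.mem_univ i) (fun j => wt (q j) (x j)),
      Finset.prod_eq_mul_prod_sdiff_singleton_of_mem (Finset.mem_univ i)
        (fun j => wt (q j) (Function.update x i (! x i) j))]
    have : ∏ j ∈ Finset.univ \ {i}, wt (q j) (Function.update x i (! x i) j)
        = ∏ j ∈ Finset.univ \ {i}, wt (q j) (x j) := by
      refine Finset.prod_congr rfl fun j hj => ?_
      rw [Function.update_of_ne]; simpa using hj
    rw [this]
    simp only [Function.update_idem, Function.update_self]
    rcases hx : x i with _ | _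
    · have : Function.update x i false = x := by rw [← hx]; simp
      simp only [this, wt]; simp; ring
    · have : Function.update x i true = x := by rw [← hx]; simp
      simp only [this, wt]; simp; ring
  · intro x _ h
    have := congrFun h i
    simp at this
  · intro x; simp
  · intro x; simp

lemma Ex_congr {f g : (ι → Bool) → ℝ} (h : ∀ x, f x = g x) : Ex q f = Ex q g := by
  rw [funext h]

lemma Ex_var (S : Finset ι) :
    Ex q (fun x => (∑ i ∈ S, (bt (x i) - q i)) ^ 2) = ∑ i ∈ S, q i * (1 - q i) := by
  induction S using Finset.induction_on with
  | empty => simp [Ex_const]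
  | insert k T hk ih =>
    rw [Finset.sum_insert hk, ← ih, Ex_resample k, Ex_resample k (q := q) (f := fun x => (∑ i ∈ T, (bt (x i) - q i)) ^ 2)]
    rw [← Ex_const (q := q) (q k * (1 - q k)), ← Ex_add]
    refine Ex_congr fun x => ?_
    have e : ∀ b, ∑ i ∈ T, (bt (Function.update x k b i) - q i) = ∑ i ∈ T, (bt (x i) - q i) := by
      intro b
      refine Finset.sum_congr rfl fun j hj => ?_
      rw [Function.update_of_ne]; rintro rfl; exact hk hj
    simp only [Finset.sum_insert hk, e, Function.update_self]
    simp [bt]; ring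

lemma Ex_or {a u a' : ℝ} (h : a' = a + u - a * u) (f : (ι → Bool) → ℝ) :
    Ex (fun _ : ι => a) (fun x => Ex (fun _ : ι => u) (fun y => f (fun i => x i || y i)))
      = Ex (fun _ : ι => a') f := by
  have key : ∀ T : Finset ι, Ex (fun _ : ι => a') (fun z => Ex (fun _ : ι => a) (fun x =>
      Ex (fun _ : ι => u) (fun y => f (fun i => if i ∈ T then x i || y i else z i))))
      = Ex (fun _ : ι => a') f := by
    intro T
    induction T using Finset.induction_on with
    | empty => simp [Ex_const]
    | insert k T hk ih =>
      rw [← ih]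
      rw [Ex_resample (q := fun _ : ι => a') k (fun z => Ex (fun _ : ι => a) (fun x =>
        Ex (fun _ : ι => u) (fun y => f (fun i => if i ∈ T then x i || y i else z i))))]
      refine Ex_congr fun z => ?_
      rw [Ex_resample k]
      rw [← Ex_mul, ← Ex_mul, ← Ex_add]
      refine Ex_congr fun x => ?_
      rw [Ex_resample k, Ex_resample k (f := fun y => f _)]
      simp only [← Ex_mul, ← Ex_add]
      refine Ex_congr fun y => ?_
      have e : ∀ b c, (fun i => if i ∈ insert k T then Function.update x k b i || Function.update y k c i else z i)
        = Function.update (fun i => if i ∈ T then x i || y i else z i) k (b || c) := by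
        intro b c; funext i
        by_cases hi : i = k
        · subst hi; simp
        · simp [hi]
      have e' : ∀ b, (fun i => if i ∈ T then x i || y i else Function.update z k b i)
        = Function.update (fun i => if i ∈ T then x i || y i else z i) k b := by
        intro b; funext i
        by_cases hi : i = k
        · subst hi; simp [hk]
        · simp [hi]
      simp only [e, e', h]
      simp; ring
  have := key Finset.univ
  simpa [Ex_const] using this

end


def f1 (s : Bool × Bool) (x : Bool) : Bool := if s.1 = s.2 then (!s.1 && x) else s.1
def f2 (s : Bool × Bool) (x : Bool) : Bool := if s.1 = s.2 then (!s.1 && x) else s.2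

/-- horizontal and vertical increments at `(i,j)` -/
def HV (I J : ℕ → Bool) (ξ : ℕ → ℕ → Bool) : ℕ → ℕ → Bool × Bool
  | 0, 0 => (I 0, J 0)
  | 0, j + 1 => (f1 (HV I J ξ 0 j) (ξ 0 j), J (j + 1))
  | i + 1, 0 => (I (i + 1), f2 (HV I J ξ i 0) (ξ i 0))
  | i + 1, j + 1 => (f1 (HV I J ξ (i + 1) j) (ξ (i + 1) j), f2 (HV I J ξ i (j + 1)) (ξ i (j + 1)))
termination_by i j => i + j

section
variable {I J : ℕ → Bool} {ξ : ℕ → ℕ → Bool}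

lemma HV_h0 (i : ℕ) : (HV I J ξ i 0).1 = I i := by cases i <;> simp [HV]
lemma HV_v0 (j : ℕ) : (HV I J ξ 0 j).2 = J j := by cases j <;> simp [HV]
lemma HV_h (i j : ℕ) : (HV I J ξ i (j + 1)).1 = f1 (HV I J ξ i j) (ξ i j) := by
  cases i <;> rw [HV]
lemma HV_v (i j : ℕ) : (HV I J ξ (i + 1) j).2 = f2 (HV I J ξ i j) (ξ i j) := by
  cases j <;> rw [HV]

lemma HV_indep {ξ' : ℕ → ℕ → Bool} (m r : ℕ) (h : ∀ i j, (i ≠ m ∨ j ≠ r) → ξ i j = ξ' i j) :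
    ∀ n i j, i + j ≤ n → ((i < m ∨ j ≤ r) → (HV I J ξ i j).1 = (HV I J ξ' i j).1) ∧
      ((i ≤ m ∨ j < r) → (HV I J ξ i j).2 = (HV I J ξ' i j).2) := by
  intro n
  induction n with
  | zero =>
    intro i j hij
    obtain rfl : i = 0 := by omega
    obtain rfl : j = 0 := by omega
    simp [HV_h0, HV_v0]
  | succ n ih =>
    intro i j hij
    constructor
    · intro hc
      cases j with
      | zero => simp [HV_h0]
      | succ j =>
        rw [HV_h, HV_h]
        obtain ⟨h1, h2⟩ := ih i j (by omega)
        have : HV I J ξ i j = HV I J ξ' i j := Prod.ext (h1 (by omega)) (h2 (by omega))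
        rw [this, h i j (by omega)]
    · intro hc
      cases i with
      | zero => simp [HV_v0]
      | succ i =>
        rw [HV_v, HV_v]
        obtain ⟨h1, h2⟩ := ih i j (by omega)
        have : HV I J ξ i j = HV I J ξ' i j := Prod.ext (h1 (by omega)) (h2 (by omega))
        rw [this, h i j (by omega)]

/-- the height function -/
def GH (I J : ℕ → Bool) (ξ : ℕ → ℕ → Bool) (i j : ℕ) : ℝ :=
  ∑ k ∈ Finset.range i, bt (I k) + ∑ k ∈ Finset.range j, bt (HV I J ξ i k).2

lemma GH_up (i j : ℕ) : GH I J ξ i (j + 1) = GH I J ξ i j + bt (HV I J ξ i j).2 := by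
  simp [GH, Finset.sum_range_succ]; ring

lemma GH_right (i j : ℕ) : GH I J ξ (i + 1) j = GH I J ξ i j + bt (HV I J ξ i j).1 := by
  induction j with
  | zero => simp [GH, Finset.sum_range_succ, HV_h0]
  | succ j ih =>
    rw [GH_up, GH_up, ih, HV_h, HV_v]
    rcases HV I J ξ i j with ⟨_ | _, _ | _⟩ <;> rcases ξ i j with _ | _ <;> simp [f1, f2, bt]

lemma GH_h0 (i : ℕ) : GH I J ξ i 0 = ∑ k ∈ Finset.range i, bt (I k) := by simp [GH]
lemma GH_v0 (j : ℕ) : GH I J ξ 0 j = ∑ k ∈ Finset.range j, bt (J k) := by simp [GH, HV_v0]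

lemma GH_rec (i j : ℕ) : GH I J ξ (i + 1) (j + 1) =
    max (max (GH I J ξ i (j + 1)) (GH I J ξ (i + 1) j)) (GH I J ξ i j + bt (ξ i j)) := by
  rw [GH_up (i + 1), GH_right, GH_up, HV_v, add_assoc, max_add_add_left, max_add_add_left]
  congr 1
  rcases HV I J ξ i j with ⟨_ | _, _ | _⟩ <;> rcases ξ i j with _ | _ <;> simp [f2, bt]

/-- last passage time without sources -/
def LL (ξ : ℕ → ℕ → Bool) (i j : ℕ) : ℝ := GH (fun _ => false) (fun _ => false) ξ i j

lemma LL_le (i j : ℕ) : LL ξ i j ≤ GH I J ξ i j := by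
  have b0 : ∀ b, 0 ≤ bt b := by intro b; cases b <;> simp [bt]
  induction i generalizing j with
  | zero => simp only [LL, GH_v0]; exact Finset.sum_le_sum fun k _ => by simpa [bt] using b0 _
  | succ i ih =>
    induction j with
    | zero => simp only [LL, GH_h0]; exact Finset.sum_le_sum fun k _ => by simpa [bt] using b0 _
    | succ j jh =>
      have := ih j; have := ih (j+1)
      simp only [LL] at *
      rw [GH_rec, GH_rec]; gcongr

lemma compare {I' J' I'' J'' : ℕ → Bool} (d : ℕ) (hI : ∀ i, bt (I i) ≤ bt (I' i))
    (hJ : ∀ j, bt (J j) ≤ bt (J'' j)) (i j : ℕ) :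
    GH I J ξ i j ≤ max (max (∑ k ∈ Finset.range d, bt (I k) + ∑ k ∈ Finset.range d, bt (J k) + LL ξ i j)
      (GH I' J' ξ i j - (∑ k ∈ Finset.range d, bt (I' k) - ∑ k ∈ Finset.range d, bt (I k))))
      (GH I'' J'' ξ i j - (∑ k ∈ Finset.range d, bt (J'' k) - ∑ k ∈ Finset.range d, bt (J k))) := by
  have b0 : ∀ b, 0 ≤ bt b := by intro b; cases b <;> simp [bt]
  have s0 : ∀ (A : ℕ → Bool) n, 0 ≤ ∑ k ∈ Finset.range n, bt (A k) :=
    fun A n => Finset.sum_nonneg fun k _ => b0 _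
  have mono : ∀ (A : ℕ → Bool) i, i ≤ d → ∑ k ∈ Finset.range i, bt (A k) ≤ ∑ k ∈ Finset.range d, bt (A k) :=
    fun A i h => Finset.sum_le_sum_of_subset_of_nonneg (Finset.range_mono h) fun k _ _ => b0 _
  have diff : ∀ (A A' : ℕ → Bool), (∀ i, bt (A i) ≤ bt (A' i)) → ∀ i, d ≤ i →
      ∑ k ∈ Finset.range i, bt (A k) ≤ ∑ k ∈ Finset.range i, bt (A' k) -
      (∑ k ∈ Finset.range d, bt (A' k) - ∑ k ∈ Finset.range d, bt (A k)) := by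
    intro A A' h i hi
    have := Finset.sum_le_sum_of_subset_of_nonneg (f := fun k => bt (A' k) - bt (A k))
      (Finset.range_mono hi) fun k _ _ => by linarith [h k]
    simp only [Finset.sum_sub_distrib] at this
    linarith
  have l0 : ∀ n, ∑ k ∈ Finset.range n, bt false = 0 := by intro n; simp [bt]
  induction i generalizing j with
  | zero =>
    simp only [LL, GH_v0, l0]
    rcases le_total j d with h | h
    · refine le_trans ?_ (le_max_left _ _)
      refine le_trans ?_ (le_max_left _ _)
      linarith [mono J j h, s0 I d]
    · refine le_trans ?_ (le_max_right _ _)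
      exact diff J J'' hJ j h
  | succ i ih =>
    induction j with
    | zero =>
      simp only [LL, GH_h0, l0]
      rcases le_total (i+1) d with h | h
      · refine le_trans ?_ (le_max_left _ _)
        refine le_trans ?_ (le_max_left _ _)
        linarith [mono I _ h, s0 J d]
      · refine le_trans ?_ (le_max_left _ _)
        refine le_trans ?_ (le_max_right _ _)
        exact diff I I' hI _ h
    | succ j jh =>
      have h1 := ih j
      have h2 := ih (j+1)
      have e : ∀ (A B : ℕ → Bool), GH A B ξ i (j+1) ≤ GH A B ξ (i+1) (j+1) ∧
          GH A B ξ (i+1) j ≤ GH A B ξ (i+1) (j+1) ∧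
          GH A B ξ i j + bt (ξ i j) ≤ GH A B ξ (i+1) (j+1) := by
        intro A B
        rw [GH_rec]; exact ⟨by simp, by simp, by simp⟩
      obtain ⟨p1, p2, p3⟩ := e I' J'
      obtain ⟨q1, q2, q3⟩ := e I'' J''
      obtain ⟨r1, r2, r3⟩ := e (fun _ => false) (fun _ => false)
      simp only [LL] at *
      rw [GH_rec (I := I) (J := J)]
      refine max_le (max_le ?_ ?_) ?_ <;> simp only [le_max_iff] at *
      · rcases h2 with (h | h) | h
        · left; left; linarith
        · left; right; linarith
        · right; linarith
      · rcases jh with (h | h) | h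
        · left; left; linarith
        · left; right; linarith
        · right; linarith
      · rcases h1 with (h | h) | h
        · left; left; linarith
        · left; right; linarith
        · right; linarith
end

def ex1 {N : ℕ} (x : Fin N → Bool) (i : ℕ) : Bool := if h : i < N then x ⟨i, h⟩ else false
def ex2 {N : ℕ} (x : Fin N × Fin N → Bool) (i j : ℕ) : Bool :=
  if h : i < N ∧ j < N then x (⟨i, h.1⟩, ⟨j, h.2⟩) else false

/-- the state along a path -/
def Xh {N : ℕ} (I J : Fin N → Bool) (ξ : Fin N × Fin N → Bool) (m r : ℕ) (i : Fin N) : Bool :=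
  (HV (ex1 I) (ex1 J) (ex2 ξ) i (if (i : ℕ) < m then N else if (i : ℕ) = m then r else 0)).1
def Xv {N : ℕ} (I J : Fin N → Bool) (ξ : Fin N × Fin N → Bool) (m r : ℕ) (j : Fin N) : Bool :=
  (HV (ex1 I) (ex1 J) (ex2 ξ) (if (j : ℕ) < r then m + 1 else m) j).2

lemma local_burke {N : ℕ} {a b p : ℝ} (hab : a * b = (1 - a) * (1 - b) * p) (m r : Fin N)
    (Φ : (Fin N → Bool) → (Fin N → Bool) → ℝ) :
    Ex (fun _ : Fin N => a) (fun h => Ex (fun _ : Fin N => b) (fun v =>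
      p * Φ (Function.update h m (f1 (h m, v r) true)) (Function.update v r (f2 (h m, v r) true))
      + (1 - p) * Φ (Function.update h m (f1 (h m, v r) false)) (Function.update v r (f2 (h m, v r) false))))
    = Ex (fun _ : Fin N => a) (fun h => Ex (fun _ : Fin N => b) (fun v => Φ h v)) := by
  rw [Ex_resample m, Ex_resample m (f := fun h => Ex (fun _ : Fin N => b) (fun v => Φ h v))]
  refine Ex_congr fun h => ?_
  simp only [← Ex_mul, ← Ex_add]
  rw [Ex_resample r, Ex_resample r (f := fun v => a * _ + _)]
  refine Ex_congr fun v => ?_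
  simp only [Function.update_self, Function.update_idem]
  simp only [f1, f2]
  simp
  linear_combination (Φ (Function.update h m false) (Function.update v r false)
    - Φ (Function.update h m true) (Function.update v r true)) * hab

lemma burke_path {N : ℕ} {a b p : ℝ} (hab : a * b = (1 - a) * (1 - b) * p) (m : ℕ) (hm : m < N) (r : ℕ) (hr : r ≤ N)
    (ih : ∀ Φ : (Fin N → Bool) → (Fin N → Bool) → ℝ,
      Ex (fun _ : Fin N => a) (fun I => Ex (fun _ : Fin N => b) (fun J =>
      Ex (fun _ : Fin N × Fin N => p) (fun ξ => Φ (Xh I J ξ m 0) (Xv I J ξ m 0)))) =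
      Ex (fun _ : Fin N => a) (fun h => Ex (fun _ : Fin N => b) (fun v => Φ h v)))
    (Φ : (Fin N → Bool) → (Fin N → Bool) → ℝ) :
    Ex (fun _ : Fin N => a) (fun I => Ex (fun _ : Fin N => b) (fun J =>
      Ex (fun _ : Fin N × Fin N => p) (fun ξ => Φ (Xh I J ξ m r) (Xv I J ξ m r)))) =
    Ex (fun _ : Fin N => a) (fun h => Ex (fun _ : Fin N => b) (fun v => Φ h v)) := by
  induction r generalizing Φ with
  | zero => exact ih Φ
  | succ r rh =>
    rw [← local_burke hab ⟨m, hm⟩ ⟨r, hr⟩ Φ]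
    refine Eq.trans ?_ (rh (by omega) _)
    refine Ex_congr fun I => Ex_congr fun J => ?_
    conv_lhs => rw [Ex_resample (⟨m, hm⟩, ⟨r, hr⟩)]
    conv_rhs => rw [Ex_resample (⟨m, hm⟩, ⟨r, hr⟩)]
    refine Ex_congr fun ξ => ?_
    -- independence of the current bit
    have ind : ∀ c c', ∀ i j, (i ≠ m ∨ j ≠ r) →
        ex2 (Function.update ξ (⟨m, hm⟩, ⟨r, hr⟩) c) i j = ex2 (Function.update ξ (⟨m, hm⟩, ⟨r, hr⟩) c') i j := by
      intro c c' i j hij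
      unfold ex2
      split_ifs with h
      · rw [Function.update_of_ne, Function.update_of_ne] <;>
        · simp only [ne_eq, Prod.mk.injEq, Fin.mk.injEq]; omega
      · rfl
    have exv : ∀ c, ex2 (Function.update ξ (⟨m, hm⟩, ⟨r, hr⟩) c) m r = c := by
      intro c; have : r < N := hr
      simp [ex2, hm, this]
    have eh : ∀ c c', Xh I J (Function.update ξ (⟨m, hm⟩, ⟨r, hr⟩) c) m r =
        Xh I J (Function.update ξ (⟨m, hm⟩, ⟨r, hr⟩) c') m r := by
      intro c c'; funext i
      refine (HV_indep m r (ind c c') _ _ _ le_rfl).1 ?_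
      split_ifs <;> omega
    have ev : ∀ c c', Xv I J (Function.update ξ (⟨m, hm⟩, ⟨r, hr⟩) c) m r =
        Xv I J (Function.update ξ (⟨m, hm⟩, ⟨r, hr⟩) c') m r := by
      intro c c'; funext j
      refine (HV_indep m r (ind c c') _ _ _ le_rfl).2 ?_
      split_ifs <;> omega
    have st : ∀ ξ : Fin N × Fin N → Bool, Xh I J ξ m (r+1) = Function.update (Xh I J ξ m r) ⟨m, hm⟩
        (f1 (Xh I J ξ m r ⟨m, hm⟩, Xv I J ξ m r ⟨r, hr⟩) (ex2 ξ m r)) ∧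
        Xv I J ξ m (r+1) = Function.update (Xv I J ξ m r) ⟨r, hr⟩
        (f2 (Xh I J ξ m r ⟨m, hm⟩, Xv I J ξ m r ⟨r, hr⟩) (ex2 ξ m r)) := by
      intro ξ
      constructor
      · funext i
        by_cases hi : i = ⟨m, hm⟩
        · subst hi
          simp [Xh, Xv, HV_h]
        · have : (i : ℕ) ≠ m := fun h => hi (Fin.ext h)
          rw [Function.update_of_ne hi]; simp [Xh, this]
      · funext j
        by_cases hj : j = ⟨r, hr⟩
        · subst hj
          simp [Xh, Xv, HV_v]
        · have : (j : ℕ) ≠ r := fun h => hj (Fin.ext h)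
          rw [Function.update_of_ne hj]
          have : ((j : ℕ) < r + 1) ↔ ((j : ℕ) < r) := by omega
          simp [Xv, this]
    simp only [(st _).1, (st _).2, exv, eh false true, ev false true]
    ring

lemma burke {N : ℕ} {a b p : ℝ} (hab : a * b = (1 - a) * (1 - b) * p) (m : ℕ) (hm : m ≤ N)
    (Φ : (Fin N → Bool) → (Fin N → Bool) → ℝ) :
    Ex (fun _ : Fin N => a) (fun I => Ex (fun _ : Fin N => b) (fun J =>
      Ex (fun _ : Fin N × Fin N => p) (fun ξ => Φ (Xh I J ξ m 0) (Xv I J ξ m 0)))) =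
    Ex (fun _ : Fin N => a) (fun h => Ex (fun _ : Fin N => b) (fun v => Φ h v)) := by
  induction m generalizing Φ with
  | zero =>
    refine Ex_congr fun I => Ex_congr fun J => ?_
    have : ∀ ξ, Xh I J ξ 0 0 = I ∧ Xv I J ξ 0 0 = J := by
      intro ξ; constructor
      · funext i; simp [Xh, HV_h0, ex1]
      · funext i; simp [Xv, HV_v0, ex1]
    simp only [(this _).1, (this _).2, Ex_const]
  | succ m mh =>
    rw [← burke_path hab m (by omega) N le_rfl (mh (by omega)) Φ]
    refine Ex_congr fun I => Ex_congr fun J => Ex_congr fun ξ => ?_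
    congr 1
    · funext i
      unfold Xh
      congr 2
      split_ifs <;> omega
    · funext j; simp [Xv]

/-- variance of the number of points on the right boundary -/
lemma burke_var {N : ℕ} {a b p : ℝ} (hab : a * b = (1 - a) * (1 - b) * p) :
    Ex (fun _ : Fin N => a) (fun I => Ex (fun _ : Fin N => b) (fun J =>
      Ex (fun _ : Fin N × Fin N => p) (fun ξ =>
      (∑ j ∈ Finset.range N, bt (HV (ex1 I) (ex1 J) (ex2 ξ) N j).2 - N * b) ^ 2))) = N * (b * (1 - b)) := by
  have := burke hab N le_rfl (fun _ v => (∑ j, (bt (v j) - b)) ^ 2)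
  rw [Ex_const, Ex_var] at this
  rw [show ∑ i : Fin N, b * (1 - b) = N * (b * (1 - b)) by simp] at this
  rw [← this]
  refine Ex_congr fun I => Ex_congr fun J => Ex_congr fun ξ => ?_
  congr 1
  rw [Finset.sum_sub_distrib, Finset.sum_range]
  simp [Xv]


open Classical in
def ind (P : Prop) : ℝ := if P then 1 else 0

lemma ind_true {P : Prop} (h : P) : ind P = 1 := by simp [ind, h]
lemma ind_false {P : Prop} (h : ¬ P) : ind P = 0 := by simp [ind, h]
lemma ind_nonneg (P : Prop) : 0 ≤ ind P := by unfold ind; split_ifs <;> norm_num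
lemma ind_le_one (P : Prop) : ind P ≤ 1 := by unfold ind; split_ifs <;> norm_num
lemma ind_mono {P Q : Prop} (h : P → Q) : ind P ≤ ind Q := by
  by_cases hp : P
  · rw [ind_true hp, ind_true (h hp)]
  · rw [ind_false hp]; exact ind_nonneg _

lemma sum_var {N : ℕ} (a : ℝ) (d : ℕ) (hd : d ≤ N) :
    Ex (fun _ : Fin N => a) (fun I => (∑ k ∈ Finset.range d, bt (ex1 I k) - d * a) ^ 2) = d * (a * (1 - a)) := by
  have := Ex_var (q := fun _ : Fin N => a) (Finset.univ.map (Fin.castLEEmb hd))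
  simp only [Finset.sum_map] at this
  simp only [Finset.sum_const, Finset.card_univ, Fintype.card_fin, nsmul_eq_mul] at this
  rw [← this]
  refine Ex_congr fun I => ?_
  congr 1
  rw [Finset.sum_sub_distrib, Finset.sum_range]
  simp only [Finset.sum_const, Finset.card_univ, Fintype.card_fin, nsmul_eq_mul]
  congr 1
  refine Finset.sum_congr rfl fun k _ => ?_
  have : (k : ℕ) < N := lt_of_lt_of_le k.2 hd
  simp [ex1, this, Fin.castLE]

lemma odds {x : ℝ} (hx : 0 ≤ x) : 0 ≤ x / (1 + x) ∧ x / (1 + x) ≤ 1 ∧ x / (1 + x) ≤ x ∧ x - x ^ 2 ≤ x / (1 + x) := by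
  have h1 : 0 < 1 + x := by linarith
  refine ⟨by positivity, ?_, ?_, ?_⟩
  · rw [div_le_one h1]; linarith
  · rw [div_le_iff₀ h1]; nlinarith
  · rw [le_div_iff₀ h1]; nlinarith [mul_nonneg hx (sq_nonneg x)]

lemma odds_prod {x y p : ℝ} (hx : 0 ≤ x) (hy : 0 ≤ y) (h : x * y = p) :
    x / (1 + x) * (y / (1 + y)) = (1 - x / (1 + x)) * (1 - y / (1 + y)) * p := by
  have h1 : 1 + x ≠ 0 := by linarith
  have h2 : 1 + y ≠ 0 := by linarith
  subst h; field_simp; ring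

lemma cheb {D e : ℝ} (he : 0 < e) (h : e ≤ |D|) : 1 ≤ D ^ 2 / e ^ 2 := by
  rw [le_div_iff₀ (by positivity), one_mul, ← sq_abs D]
  gcongr

lemma LL_upper {N : ℕ} (hN : 1 ≤ N) {s ε : ℝ} (hs : 0 < s) (hsN : s ≤ N) (hε : 0 < ε) :
    Ex (fun _ : Fin N × Fin N => (s / N) ^ 2) (fun ξ => ind ((2 + ε) * s ≤ LL (ex2 ξ) N N)) ≤ 8 / (ε ^ 2 * s) := by
  have hN' : (0:ℝ) < N := by exact_mod_cast hN
  set o := s / N with ho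
  have ho0 : 0 ≤ o := by positivity
  have ho1 : o ≤ 1 := by rw [ho, div_le_one hN']; exact hsN
  have hNo : N * o = s := by rw [ho]; field_simp
  obtain ⟨a0, a1, ao, -⟩ := odds ho0
  have hab := odds_prod ho0 ho0 (show o * o = o ^ 2 by ring)
  set a := o / (1 + o) with ha
  have hp0 : 0 ≤ o ^ 2 := by positivity
  have hp1 : o ^ 2 ≤ 1 := by nlinarith
  have hNa : N * a ≤ s := by rw [← hNo]; gcongr
  set e := ε * s / 2 with he
  have he0 : 0 < e := by positivity
  have key : Ex (fun _ : Fin N => a) (fun I => Ex (fun _ : Fin N => a) (fun J =>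
      Ex (fun _ : Fin N × Fin N => o ^ 2) (fun ξ => ind ((2 + ε) * s ≤ LL (ex2 ξ) N N)))) ≤
      Ex (fun _ : Fin N => a) (fun I => Ex (fun _ : Fin N => a) (fun J =>
      Ex (fun _ : Fin N × Fin N => o ^ 2) (fun ξ =>
        (∑ k ∈ Finset.range N, bt (ex1 I k) - N * a) ^ 2 / e ^ 2 +
        (∑ j ∈ Finset.range N, bt (HV (ex1 I) (ex1 J) (ex2 ξ) N j).2 - N * a) ^ 2 / e ^ 2))) := by
    refine Ex_mono (fun _ => a0) (fun _ => a1) fun I => Ex_mono (fun _ => a0) (fun _ => a1) fun J =>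
      Ex_mono (fun _ => hp0) (fun _ => hp1) fun ξ => ?_
    by_cases h : (2 + ε) * s ≤ LL (ex2 ξ) N N
    · rw [ind_true h]
      have h2 := h.trans (LL_le (I := ex1 I) (J := ex1 J) N N)
      unfold GH at h2
      set X := ∑ k ∈ Finset.range N, bt (ex1 I k)
      set Y := ∑ j ∈ Finset.range N, bt (HV (ex1 I) (ex1 J) (ex2 ξ) N j).2
      rcases le_or_gt e (X - N * a) with h3 | h3
      · have := cheb he0 (h3.trans (le_abs_self _))
        have : 0 ≤ (Y - N * a) ^ 2 / e ^ 2 := by positivity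
        linarith
      · have h4 : e ≤ Y - N * a := by linarith
        have := cheb he0 (h4.trans (le_abs_self _))
        have : 0 ≤ (X - N * a) ^ 2 / e ^ 2 := by positivity
        linarith
    · rw [ind_false h]; positivity
  simp only [Ex_add, Ex_div] at key
  rw [burke_var hab] at key
  simp only [Ex_const] at key
  rw [sum_var _ _ le_rfl] at key
  refine key.trans ?_
  rw [← add_div, div_le_div_iff₀ (by positivity) (by positivity), he]
  have : N * (a * (1 - a)) ≤ s := by
    have : a * (1 - a) ≤ a := by nlinarith
    have : (N:ℝ) * (a * (1 - a)) ≤ N * a := by gcongr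
    linarith
  have h2 := mul_le_mul_of_nonneg_right this (show 0 ≤ ε ^ 2 * s by positivity)
  nlinarith

abbrev B1 (N : ℕ) := Fin N → Bool
abbrev B2 (N : ℕ) := Fin N × Fin N → Bool

def E7 (N : ℕ) (a u b p : ℝ) (F : B1 N → B1 N → B1 N → B1 N → B1 N → B1 N → B2 N → ℝ) : ℝ :=
  Ex (fun _ : Fin N => a) fun I => Ex (fun _ : Fin N => u) fun U =>
  Ex (fun _ : Fin N => a) fun J => Ex (fun _ : Fin N => u) fun V =>
  Ex (fun _ : Fin N => b) fun J' => Ex (fun _ : Fin N => b) fun I'' =>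
  Ex (fun _ : Fin N × Fin N => p) fun ξ => F I U J V J' I'' ξ

def orr {N : ℕ} (x y : B1 N) : B1 N := fun i => x i || y i

section
variable {N : ℕ} {a u b p : ℝ}

lemma E7_mono (a0 : 0 ≤ a) (a1 : a ≤ 1) (u0 : 0 ≤ u) (u1 : u ≤ 1) (b0 : 0 ≤ b) (b1 : b ≤ 1)
    (p0 : 0 ≤ p) (p1 : p ≤ 1) {F G : B1 N → B1 N → B1 N → B1 N → B1 N → B1 N → B2 N → ℝ}
    (h : ∀ I U J V J' I'' ξ, F I U J V J' I'' ξ ≤ G I U J V J' I'' ξ) : E7 N a u b p F ≤ E7 N a u b p G := by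
  unfold E7
  exact Ex_mono (fun _ => a0) (fun _ => a1) fun _ => Ex_mono (fun _ => u0) (fun _ => u1) fun _ =>
    Ex_mono (fun _ => a0) (fun _ => a1) fun _ => Ex_mono (fun _ => u0) (fun _ => u1) fun _ =>
    Ex_mono (fun _ => b0) (fun _ => b1) fun _ => Ex_mono (fun _ => b0) (fun _ => b1) fun _ =>
    Ex_mono (fun _ => p0) (fun _ => p1) fun _ => h _ _ _ _ _ _ _

lemma E7_add (F G : B1 N → B1 N → B1 N → B1 N → B1 N → B1 N → B2 N → ℝ) :
    E7 N a u b p (fun I U J V J' I'' ξ => F I U J V J' I'' ξ + G I U J V J' I'' ξ)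
      = E7 N a u b p F + E7 N a u b p G := by
  simp only [E7, Ex_add]

lemma E7_div (c : ℝ) (F : B1 N → B1 N → B1 N → B1 N → B1 N → B1 N → B2 N → ℝ) :
    E7 N a u b p (fun I U J V J' I'' ξ => F I U J V J' I'' ξ / c) = E7 N a u b p F / c := by
  simp only [E7, Ex_div]

variable {a' : ℝ}

def sv {N : ℕ} (c : ℝ) (d : ℕ) (I : B1 N) : ℝ := ∑ k ∈ Finset.range d, bt (ex1 I k) - d * c
def ov {N : ℕ} (c : ℝ) (I J : B1 N) (ξ : B2 N) : ℝ :=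
  ∑ j ∈ Finset.range N, bt (HV (ex1 I) (ex1 J) (ex2 ξ) N j).2 - N * c

lemma t1 (d : ℕ) (hd : d ≤ N) : E7 N a u b p (fun I _ _ _ _ _ _ => sv a d I ^ 2) = d * (a * (1 - a)) := by
  simp only [E7, Ex_const]; exact sum_var a d hd
lemma t2 (d : ℕ) (hd : d ≤ N) : E7 N a u b p (fun _ _ J _ _ _ _ => sv a d J ^ 2) = d * (a * (1 - a)) := by
  simp only [E7, Ex_const]; exact sum_var a d hd
lemma t3 (hu : a' = a + u - a * u) (d : ℕ) (hd : d ≤ N) :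
    E7 N a u b p (fun I U _ _ _ _ _ => sv a' d (orr I U) ^ 2) = d * (a' * (1 - a')) := by
  simp only [E7, Ex_const]
  exact (Ex_or hu (fun x : B1 N => sv a' d x ^ 2)).trans (sum_var a' d hd)
lemma t4 (hu : a' = a + u - a * u) (d : ℕ) (hd : d ≤ N) :
    E7 N a u b p (fun _ _ J V _ _ _ => sv a' d (orr J V) ^ 2) = d * (a' * (1 - a')) := by
  simp only [E7, Ex_const]
  exact (Ex_or hu (fun x : B1 N => sv a' d x ^ 2)).trans (sum_var a' d hd)
lemma t5 (d : ℕ) (hd : d ≤ N) : E7 N a u b p (fun _ _ _ _ _ I'' _ => sv b d I'' ^ 2) = d * (b * (1 - b)) := by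
  simp only [E7, Ex_const]; exact sum_var b d hd
lemma t6 (hab : a * a = (1 - a) * (1 - a) * p) :
    E7 N a u b p (fun I _ J _ _ _ ξ => ov a I J ξ ^ 2) = N * (a * (1 - a)) := by
  simp only [E7, Ex_const]; exact burke_var hab
lemma t7 (hu : a' = a + u - a * u) (hab : a' * b = (1 - a') * (1 - b) * p) :
    E7 N a u b p (fun I U _ _ J' _ ξ => ov b (orr I U) J' ξ ^ 2) = N * (b * (1 - b)) := by
  simp only [E7, Ex_const]
  exact (Ex_or hu (fun x : B1 N => Ex (fun _ : Fin N => b) fun J' =>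
    Ex (fun _ : Fin N × Fin N => p) fun ξ => ov b x J' ξ ^ 2)).trans (burke_var hab)
lemma t8 (hu : a' = a + u - a * u) (hab : b * a' = (1 - b) * (1 - a') * p) :
    E7 N a u b p (fun _ _ J V _ I'' ξ => ov a' I'' (orr J V) ξ ^ 2) = N * (a' * (1 - a')) := by
  simp only [E7, Ex_const]
  refine (Ex_or hu (fun x : B1 N => Ex (fun _ : Fin N => b) fun I'' =>
    Ex (fun _ : Fin N × Fin N => p) fun ξ => ov a' I'' x ξ ^ 2)).trans ?_
  rw [Ex_comm]
  exact burke_var hab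
end

lemma GH_eq {N : ℕ} (c e : ℝ) (I J : B1 N) (ξ : B2 N) :
    GH (ex1 I) (ex1 J) (ex2 ξ) N N = N * c + N * e + sv c N I + ov e I J ξ := by
  simp only [GH, sv, ov]; ring

lemma final_contra {s δ τ e A A' B D D' l x1 x2 x3 x4 x5 x6 x7 x8 x9 x10 : ℝ} (hs : 0 < s) (hδ : 0 < δ)
    (hτ : τ = 1 + δ / 2) (hes : e = δ ^ 2 * s / 100) (hδe : 100 * e ≤ δ * s)
    (n1 : A ≤ s) (n2 : s - e ≤ A) (n3 : A' ≤ τ * s) (n4 : B ≤ s * (1 - δ / 2 + δ ^ 2 / 4))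
    (n5 : D ≤ δ * s) (n6 : δ * τ * s - e - e ≤ D') (h : l < (2 - 3 * δ) * s)
    (cmp : A + A + x1 + x4 ≤ max (max (D + x2 + (D + x3) + l)
      (A' + B + x5 + x7 - (D' + x6 - (D + x2)))) (B + A' + x8 + x10 - (D' + x9 - (D + x3))))
    (l1 : -e < x1) (l4 : -e < x4) (m2 : x2 < e) (m3 : x3 < e) (m5 : x5 < e) (m7 : x7 < e)
    (m8 : x8 < e) (m10 : x10 < e) (l6 : -e < x6) (l9 : -e < x9) (r2 : x2 < e) (r3 : x3 < e) : False := by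
  have z1 : δ * τ * s = δ * s + δ ^ 2 * s / 2 := by rw [hτ]; ring
  have z2 : τ * s = s + δ * s / 2 := by rw [hτ]; ring
  have z3 : s * (1 - δ / 2 + δ ^ 2 / 4) = s - δ * s / 2 + δ ^ 2 * s / 4 := by ring
  have z4 : (2 - 3 * δ) * s = 2 * s - 3 * (δ * s) := by ring
  have z5 : 0 < δ ^ 2 * s := by positivity
  rw [le_max_iff, le_max_iff] at cmp
  rw [z1] at n6
  rw [z2] at n3
  rw [z3] at n4
  rw [z4] at h
  generalize δ ^ 2 * s = y at *
  generalize δ * s = w at *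
  subst hes
  rcases cmp with (c | c) | c <;> linarith

lemma num6 {δ τ s ε o N a' d : ℝ} (hs : 0 < s) (hε0 : 0 < ε) (hδ : 0 < δ) (hδ1 : δ ≤ 1) (hτ0 : 0 < τ) (hτ2 : τ ≤ 2)
    (ho0 : 0 ≤ o) (hNo : N * o = s) (hN : 0 < N) (a0' : 0 ≤ a') (a1' : a' ≤ 1) (aot' : τ * o - (τ * o) ^ 2 ≤ a')
    (hd2 : δ * N - 1 ≤ d) (h1 : 4 * o ≤ ε) (h2 : 1 ≤ ε * s) : δ * τ * s - ε * s - ε * s ≤ d * a' := by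
  have h3 : (δ * N - 1) * a' ≤ d * a' := by gcongr
  have h4 : N * (τ * o - (τ * o) ^ 2) ≤ N * a' := by gcongr
  have h5 : N * (τ * o - (τ * o) ^ 2) = τ * s - τ ^ 2 * o * s := by rw [← hNo]; ring
  have h6 : τ ^ 2 * o ≤ ε := by
    have : τ ^ 2 ≤ 2 ^ 2 := by gcongr
    have := mul_le_mul_of_nonneg_right this ho0
    linarith
  have h7 : τ ^ 2 * o * s ≤ ε * s := by gcongr
  have h8 : δ * (τ * s - ε * s) ≤ δ * (N * a') := by gcongr; linarith
  have h9 : δ * (ε * s) ≤ 1 * (ε * s) := by gcongr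
  have e1 : (δ * N - 1) * a' = δ * (N * a') - a' := by ring
  have e2 : δ * (τ * s - ε * s) = δ * τ * s - δ * (ε * s) := by ring
  linarith

set_option maxHeartbeats 1000000 in
lemma LL_lower {N : ℕ} (hN : 1 ≤ N) {s δ ε : ℝ} (hs : 0 < s) (hsN : s ≤ N) (hδ : 0 < δ) (hδ1 : δ ≤ 1)
    (hε : ε = δ ^ 2 / 100) (h1 : 4 * (s / N) ≤ ε) (h2 : 1 ≤ ε * s) :
    Ex (fun _ : Fin N × Fin N => (s / N) ^ 2) (fun ξ => ind (LL (ex2 ξ) N N < (2 - 3 * δ) * s))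
      ≤ 20 / (ε ^ 2 * s) := by
  have hN' : (0:ℝ) < N := by exact_mod_cast hN
  have hε0 : 0 < ε := by rw [hε]; positivity
  set o := s / N with ho
  have ho0 : 0 ≤ o := by positivity
  have ho1 : o ≤ 1 := by rw [ho, div_le_one hN']; exact hsN
  have hNo : N * o = s := by rw [ho]; field_simp
  set τ := 1 + δ / 2 with hτ
  have hτ0 : 0 < τ := by positivity
  have hτ2 : τ ≤ 2 := by rw [hτ]; linarith
  obtain ⟨a0, a1, ao, ao'⟩ := odds ho0
  obtain ⟨a0', a1', aot, aot'⟩ := odds (show 0 ≤ τ * o by positivity)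
  obtain ⟨b0, b1, bo, bo'⟩ := odds (show 0 ≤ o / τ by positivity)
  have hab := odds_prod ho0 ho0 (show o * o = o ^ 2 by ring)
  have hab1 := odds_prod (show 0 ≤ τ * o by positivity) (show 0 ≤ o / τ by positivity)
    (show τ * o * (o / τ) = o ^ 2 by field_simp)
  have hab2 := odds_prod (show 0 ≤ o / τ by positivity) (show 0 ≤ τ * o by positivity)
    (show (o / τ) * (τ * o) = o ^ 2 by field_simp)
  have haa' : o / (1 + o) ≤ τ * o / (1 + τ * o) := by
    rw [div_le_div_iff₀ (by positivity) (by positivity)]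
    have : o ≤ τ * o := le_mul_of_one_le_left ho0 (by rw [hτ]; linarith only [hδ])
    linarith only [this]
  have ha1 : o / (1 + o) < 1 := by rw [div_lt_one (by positivity)]; linarith
  set a := o / (1 + o) with ha
  set a' := τ * o / (1 + τ * o) with ha'
  set b := o / τ / (1 + o / τ) with hb
  clear_value a a' b
  set u := (a' - a) / (1 - a) with hu
  have hu0 : 0 ≤ u := div_nonneg (by linarith) (by linarith)
  have hu1 : u ≤ 1 := by rw [hu, div_le_one (by linarith)]; linarith
  have hu' : a' = a + u - a * u := by
    have : (1 - a) ≠ 0 := by linarith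
    rw [hu]; field_simp; ring
  clear_value u
  have hp0 : 0 ≤ o ^ 2 := by positivity
  have hp1 : o ^ 2 ≤ 1 := pow_le_one₀ ho0 ho1
  -- numerical facts
  have n1 : N * a ≤ s := by rw [← hNo]; gcongr
  have n2 : s - ε * s ≤ N * a := by
    have : N * (o - o ^ 2) ≤ N * a := by gcongr
    have e : N * (o - o ^ 2) = s - o * s := by rw [← hNo]; ring
    have : o * s ≤ ε * s := by gcongr; linarith
    linarith
  have n3 : N * a' ≤ τ * s := by
    have : N * a' ≤ N * (τ * o) := by gcongr
    have e : N * (τ * o) = τ * s := by rw [← hNo]; ring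
    linarith
  have n4 : N * b ≤ s * (1 - δ / 2 + δ ^ 2 / 4) := by
    have h3 : N * b ≤ N * (o / τ) := by gcongr
    have h4 : N * (o / τ) = s / τ := by rw [← hNo]; ring
    have h5 : s / τ ≤ s * (1 - δ / 2 + δ ^ 2 / 4) := by
      rw [div_le_iff₀ hτ0, hτ]
      have : s * (1 - δ / 2 + δ ^ 2 / 4) * (1 + δ / 2) = s + s * (δ ^ 3 / 8) := by ring
      rw [this]; have : 0 ≤ s * (δ ^ 3 / 8) := by positivity
      linarith
    linarith
  set d := ⌊δ * N⌋₊ with hd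
  have hdN : d ≤ N := by
    have : (d:ℝ) ≤ N := (Nat.floor_le (by positivity)).trans (mul_le_of_le_one_left hN'.le hδ1)
    exact_mod_cast this
  have hd1 : (d:ℝ) ≤ δ * N := Nat.floor_le (by positivity)
  have hd2 : δ * N - 1 ≤ d := (Nat.sub_one_lt_floor _).le
  clear_value d
  have n5 : d * a ≤ δ * s := by
    have : d * a ≤ δ * N * a := by gcongr
    have := mul_le_mul_of_nonneg_left n1 hδ.le
    linarith
  have n6 : δ * τ * s - ε * s - ε * s ≤ d * a' :=
    num6 hs hε0 hδ hδ1 hτ0 hτ2 ho0 hNo hN' a0' a1' aot' hd2 h1 h2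
  set e := ε * s with he
  have he0 : 0 < e := by positivity
  have hes : e = δ ^ 2 * s / 100 := by rw [he, hε]; ring
  have hδe : 100 * e ≤ δ * s := by
    rw [hes]; have : 0 ≤ δ * s * (1 - δ) := mul_nonneg (by positivity) (by linarith)
    linarith only [this]
  have key : E7 N a u b (o ^ 2) (fun I U J V J' I'' ξ => ind (LL (ex2 ξ) N N < (2 - 3 * δ) * s)) ≤
      E7 N a u b (o ^ 2) (fun I U J V J' I'' ξ =>
        (sv a N I ^ 2 + (sv a d I ^ 2 + (sv a d J ^ 2 + (ov a I J ξ ^ 2 + (sv a' N (orr I U) ^ 2 +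
        (sv a' d (orr I U) ^ 2 + (ov b (orr I U) J' ξ ^ 2 + (sv b N I'' ^ 2 + (sv a' d (orr J V) ^ 2 +
        ov a' I'' (orr J V) ξ ^ 2))))))))) / e ^ 2) := by
    refine E7_mono a0 a1 hu0 hu1 b0 b1 hp0 hp1 fun I U J V J' I'' ξ => ?_
    by_cases h : LL (ex2 ξ) N N < (2 - 3 * δ) * s
    swap
    · rw [ind_false h]; positivity
    rw [ind_true h, le_div_iff₀ (by positivity), one_mul]
    by_contra hcon
    push Not at hcon
    have small : ∀ x : ℝ, x ^ 2 < e ^ 2 → -e < x ∧ x < e := fun x hx => by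
      have := abs_lt_of_sq_lt_sq hx he0.le
      exact abs_lt.mp this
    have orI : ∀ (A B : B1 N) i, bt (ex1 A i) ≤ bt (ex1 (orr A B) i) := by
      intro A B i
      unfold ex1 orr
      split_ifs with h
      · rcases A ⟨i, h⟩ with _ | _ <;> rcases B ⟨i, h⟩ with _ | _ <;> simp [bt]
      · exact le_rfl
    have cmp := compare (ξ := ex2 ξ) (I' := ex1 (orr I U)) (J' := ex1 J') (I'' := ex1 I'')
      (J'' := ex1 (orr J V)) d (orI I U) (orI J V) N N
    rw [GH_eq a a, GH_eq a' b, GH_eq b a'] at cmp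
    have w1 : ∑ k ∈ Finset.range d, bt (ex1 I k) = d * a + sv a d I := by simp [sv]
    have w2 : ∑ k ∈ Finset.range d, bt (ex1 J k) = d * a + sv a d J := by simp [sv]
    have w3 : ∑ k ∈ Finset.range d, bt (ex1 (orr I U) k) = d * a' + sv a' d (orr I U) := by simp [sv]
    have w4 : ∑ k ∈ Finset.range d, bt (ex1 (orr J V) k) = d * a' + sv a' d (orr J V) := by simp [sv]
    rw [w1, w2, w3, w4] at cmp
    generalize sv a N I = x1 at *
    generalize sv a d I = x2 at *
    generalize sv a d J = x3 at *
    generalize ov a I J ξ = x4 at *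
    generalize sv a' N (orr I U) = x5 at *
    generalize sv a' d (orr I U) = x6 at *
    generalize ov b (orr I U) J' ξ = x7 at *
    generalize sv b N I'' = x8 at *
    generalize sv a' d (orr J V) = x9 at *
    generalize ov a' I'' (orr J V) ξ = x10 at *
    generalize LL (ex2 ξ) N N = l at *
    have q1 := sq_nonneg x1
    have q2 := sq_nonneg x2
    have q3 := sq_nonneg x3
    have q4 := sq_nonneg x4
    have q5 := sq_nonneg x5
    have q6 := sq_nonneg x6
    have q7 := sq_nonneg x7
    have q8 := sq_nonneg x8
    have q9 := sq_nonneg x9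
    have q10 := sq_nonneg x10
    obtain ⟨l1, m1⟩ := small x1 (by linarith only [hcon, q1, q2, q3, q4, q5, q6, q7, q8, q9, q10])
    obtain ⟨l2, m2⟩ := small x2 (by linarith only [hcon, q1, q2, q3, q4, q5, q6, q7, q8, q9, q10])
    obtain ⟨l3, m3⟩ := small x3 (by linarith only [hcon, q1, q2, q3, q4, q5, q6, q7, q8, q9, q10])
    obtain ⟨l4, m4⟩ := small x4 (by linarith only [hcon, q1, q2, q3, q4, q5, q6, q7, q8, q9, q10])
    obtain ⟨l5, m5⟩ := small x5 (by linarith only [hcon, q1, q2, q3, q4, q5, q6, q7, q8, q9, q10])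
    obtain ⟨l6, m6⟩ := small x6 (by linarith only [hcon, q1, q2, q3, q4, q5, q6, q7, q8, q9, q10])
    obtain ⟨l7, m7⟩ := small x7 (by linarith only [hcon, q1, q2, q3, q4, q5, q6, q7, q8, q9, q10])
    obtain ⟨l8, m8⟩ := small x8 (by linarith only [hcon, q1, q2, q3, q4, q5, q6, q7, q8, q9, q10])
    obtain ⟨l9, m9⟩ := small x9 (by linarith only [hcon, q1, q2, q3, q4, q5, q6, q7, q8, q9, q10])
    obtain ⟨l10, m10⟩ := small x10 (by linarith only [hcon, q1, q2, q3, q4, q5, q6, q7, q8, q9, q10])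
    exact final_contra hs hδ hτ hes hδe n1 n2 n3 n4 n5 n6 h cmp l1 l4 m2 m3 m5 m7 m8 m10 l6 l9 m2 m3
  have lhs : E7 N a u b (o ^ 2) (fun I U J V J' I'' ξ => ind (LL (ex2 ξ) N N < (2 - 3 * δ) * s))
      = Ex (fun _ : Fin N × Fin N => o ^ 2) (fun ξ => ind (LL (ex2 ξ) N N < (2 - 3 * δ) * s)) := by
    simp only [E7, Ex_const]
  rw [lhs, E7_div] at key
  simp only [E7_add] at key
  rw [t1 N le_rfl, t1 d hdN, t2 d hdN, t6 hab, t3 hu' N le_rfl, t3 hu' d hdN, t7 hu' hab1,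
    t5 N le_rfl, t4 hu' d hdN, t8 hu' hab2] at key
  refine key.trans ?_
  have dN : (d:ℝ) ≤ N := by exact_mod_cast hdN
  have n3' : N * a' ≤ 2 * s := n3.trans (by gcongr)
  have bnd : ∀ c : ℝ, 0 ≤ c → c ≤ 1 → N * c ≤ 2 * s → N * (c * (1 - c)) ≤ 2 * s ∧ d * (c * (1 - c)) ≤ 2 * s := by
    intro c c0 c1 hc
    have : c * (1 - c) ≤ c := by rw [mul_one_sub]; linarith only [mul_self_nonneg c]
    have h3 : (N:ℝ) * (c * (1 - c)) ≤ N * c := by gcongr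
    have h0 : 0 ≤ c * (1 - c) := mul_nonneg c0 (by linarith)
    have h4 : (d:ℝ) * (c * (1 - c)) ≤ N * (c * (1 - c)) := by gcongr
    exact ⟨by linarith only [h3, hc], by linarith only [h3, h4, hc]⟩
  obtain ⟨v1, v2⟩ := bnd a a0 a1 (by linarith)
  obtain ⟨v3, v4⟩ := bnd a' a0' a1' n3'
  have nb : N * b ≤ 2 * s := n4.trans (by
    have : δ / 2 * s * (1 - δ / 2) ≥ 0 := mul_nonneg (by positivity) (by linarith)
    have e : s * (1 - δ / 2 + δ ^ 2 / 4) = s - δ / 2 * s * (1 - δ / 2) := by ring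
    linarith)
  obtain ⟨v5, v6⟩ := bnd b b0 b1 nb
  calc _ ≤ (20 * s) / e ^ 2 := by gcongr; linarith only [v1, v2, v3, v4, v5, v6]
    _ = 20 / (ε ^ 2 * s) := by rw [he]; field_simp


/-- there is an increasing subsequence inside `C` of size at least `x` -/
def QQ {N : ℕ} (σ : Equiv.Perm (Fin N)) (C : Finset (Fin N)) (x : ℝ) : Prop :=
  ∃ s ⊆ C, IncSeq σ s ∧ x ≤ s.card

lemma sSup_card {n : ℕ} {P : Finset (Fin n) → Prop} (h0 : P ∅) (x : ℝ) :
    x ≤ ((sSup {k | ∃ s : Finset (Fin n), P s ∧ s.card = k} : ℕ) : ℝ) ↔ ∃ s, P s ∧ x ≤ s.card := by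
  have bdd : BddAbove {k | ∃ s : Finset (Fin n), P s ∧ s.card = k} :=
    ⟨n, by rintro k ⟨s, -, rfl⟩; simpa using Finset.card_le_univ s⟩
  constructor
  · intro h
    have ne : Set.Nonempty {k | ∃ s : Finset (Fin n), P s ∧ s.card = k} := ⟨0, ∅, h0, by simp⟩
    obtain ⟨s, hs, hk⟩ := Nat.sSup_mem ne bdd
    exact ⟨s, hs, by rw [hk]; exact h⟩
  · rintro ⟨s, hs, h⟩
    refine h.trans ?_
    exact_mod_cast le_csSup bdd ⟨s, hs, rfl⟩

lemma le_lis {n : ℕ} (σ : Equiv.Perm (Fin n)) (x : ℝ) : x ≤ lis σ ↔ ∃ s, IncSeq σ s ∧ x ≤ s.card :=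
  sSup_card (by intro i hi; simp at hi) x

lemma le_lds {n : ℕ} (σ : Equiv.Perm (Fin n)) (x : ℝ) : x ≤ lds σ ↔ ∃ s, DecSeq σ s ∧ x ≤ s.card :=
  sSup_card (by intro i hi; simp at hi) x

def xiOf {N : ℕ} (ρ : Equiv.Perm (Fin N)) (C : Finset (Fin N)) : B2 N :=
  fun c => decide (c.1 ∈ C ∧ ρ c.1 = c.2)

lemma LL_zero_left (ξ : ℕ → ℕ → Bool) (j : ℕ) : LL ξ 0 j = 0 := by simp [LL, GH_v0, bt]
lemma LL_zero_right (ξ : ℕ → ℕ → Bool) (i : ℕ) : LL ξ i 0 = 0 := by simp [LL, GH_h0, bt]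
lemma LL_rec (ξ : ℕ → ℕ → Bool) (i j : ℕ) : LL ξ (i + 1) (j + 1) =
    max (max (LL ξ i (j + 1)) (LL ξ (i + 1) j)) (LL ξ i j + bt (ξ i j)) := GH_rec i j

lemma ex2_xiOf {N : ℕ} (ρ : Equiv.Perm (Fin N)) (C : Finset (Fin N)) (i j : ℕ) :
    ex2 (xiOf ρ C) i j = true ↔ ∃ k ∈ C, (k : ℕ) = i ∧ (ρ k : ℕ) = j := by
  unfold ex2 xiOf
  split_ifs with h
  · simp only [decide_eq_true_eq]
    constructor
    · rintro ⟨h1, h2⟩; exact ⟨_, h1, rfl, by rw [h2]⟩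
    · rintro ⟨k, hk, rfl, hj⟩; exact ⟨hk, Fin.ext hj⟩
  · simp only [Bool.false_eq_true, false_iff]
    rintro ⟨k, hk, rfl, rfl⟩
    exact h ⟨k.2, (ρ k).2⟩

lemma LL_exists {N : ℕ} (ρ : Equiv.Perm (Fin N)) (C : Finset (Fin N)) (m r : ℕ) :
    ∃ s ⊆ C, IncSeq ρ s ∧ (∀ k ∈ s, (k : ℕ) < m ∧ (ρ k : ℕ) < r) ∧ LL (ex2 (xiOf ρ C)) m r ≤ s.card := by
  induction m generalizing r with
  | zero => exact ⟨∅, by simp, by intro i hi; simp at hi, by simp, by simp [LL_zero_left]⟩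
  | succ m mh =>
    induction r with
    | zero => exact ⟨∅, by simp, by intro i hi; simp at hi, by simp, by simp [LL_zero_right]⟩
    | succ r rh =>
      rw [LL_rec]
      set L := ex2 (xiOf ρ C)
      by_cases h1 : LL L m r + bt (L m r) ≤ max (LL L m (r+1)) (LL L (m+1) r)
      · rw [max_eq_left h1]
        rcases le_total (LL L m (r+1)) (LL L (m+1) r) with h2 | h2
        · rw [max_eq_right h2]
          obtain ⟨s, a, b, c, d⟩ := rh
          exact ⟨s, a, b, fun k hk => ⟨(c k hk).1, by have := (c k hk).2; omega⟩, d⟩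
        · rw [max_eq_left h2]
          obtain ⟨s, a, b, c, d⟩ := mh (r + 1)
          exact ⟨s, a, b, fun k hk => ⟨by have := (c k hk).1; omega, (c k hk).2⟩, d⟩
      · rw [max_eq_right (not_le.mp h1).le]
        obtain ⟨s, a, b, c, d⟩ := mh r
        by_cases hL : L m r = true
        · obtain ⟨k, hkC, hkm, hkr⟩ := (ex2_xiOf ρ C m r).mp hL
          have hks : k ∉ s := fun h => by have := (c k h).1; omega
          refine ⟨insert k s, Finset.insert_subset hkC a, ?_, ?_, ?_⟩
          · intro i hi j hj hij
            rw [Finset.mem_insert] at hi hj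
            rcases hi with rfl | hi <;> rcases hj with rfl | hj
            · exact absurd hij (lt_irrefl _)
            · have := (c j hj).1; have : (i:ℕ) < j := hij; omega
            · have := (c i hi).2; exact Fin.lt_def.mpr (by omega)
            · exact b i hi j hj hij
          · intro i hi
            rw [Finset.mem_insert] at hi
            rcases hi with rfl | hi
            · omega
            · have := c i hi; omega
          · rw [Finset.card_insert_of_notMem hks, hL]; push_cast; simp [bt]; exact d
        · refine ⟨s, a, b, fun k hk => by have := c k hk; omega, ?_⟩
          simp only [Bool.not_eq_true] at hL
          rw [hL]; simpa [bt] using d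

lemma LL_ge {N : ℕ} (ρ : Equiv.Perm (Fin N)) (C s : Finset (Fin N)) (hs : s ⊆ C) (hi : IncSeq ρ s) (m r : ℕ) :
    ((s.filter fun k : Fin N => (k : ℕ) < m ∧ (ρ k : ℕ) < r).card : ℝ) ≤ LL (ex2 (xiOf ρ C)) m r := by
  induction m generalizing r with
  | zero => simp [LL_zero_left]
  | succ m mh =>
    induction r with
    | zero => simp [LL_zero_right]
    | succ r rh =>
      rw [LL_rec]
      have card_mono : ∀ {A B : Finset (Fin N)}, A ⊆ B → (A.card : ℝ) ≤ B.card := fun h => by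
        exact_mod_cast Finset.card_le_card h
      by_cases h : ∃ k ∈ s, (k:ℕ) = m ∧ (ρ k : ℕ) ≤ r
      · obtain ⟨k, hk, hkm, hkr⟩ := h
        rcases hkr.lt_or_eq with h1 | h1
        · refine le_trans ?_ (le_max_left _ _)
          refine le_trans ?_ (le_max_right _ _)
          refine le_trans (card_mono ?_) rh
          intro i hi'
          simp only [Finset.mem_filter] at hi' ⊢
          refine ⟨hi'.1, hi'.2.1, ?_⟩
          rcases lt_trichotomy i k with h2 | h2 | h2
          · have := Fin.lt_def.mp (hi i hi'.1 k hk h2); omega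
          · rw [h2]; exact h1
          · have := Fin.lt_def.mp h2; omega
        · refine le_trans ?_ (le_max_right _ _)
          have hx : ex2 (xiOf ρ C) m r = true := (ex2_xiOf ρ C m r).mpr ⟨k, hs hk, hkm, h1⟩
          rw [hx]
          have : (s.filter fun k : Fin N => (k : ℕ) < m + 1 ∧ (ρ k : ℕ) < r + 1) ⊆
              insert k (s.filter fun k : Fin N => (k : ℕ) < m ∧ (ρ k : ℕ) < r) := by
            intro i hi'
            simp only [Finset.mem_filter, Finset.mem_insert] at hi' ⊢
            rcases lt_trichotomy i k with h2 | h2 | h2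
            · right
              have := Fin.lt_def.mp (hi i hi'.1 k hk h2)
              have := Fin.lt_def.mp h2
              exact ⟨hi'.1, by omega, by omega⟩
            · left; exact h2
            · have := Fin.lt_def.mp h2; omega
          refine (card_mono this).trans ?_
          have h3 := Finset.card_insert_le k (s.filter fun k : Fin N => (k : ℕ) < m ∧ (ρ k : ℕ) < r)
          have h4 : ((insert k (s.filter fun k : Fin N => (k : ℕ) < m ∧ (ρ k : ℕ) < r)).card : ℝ) ≤
            ((s.filter fun k : Fin N => (k : ℕ) < m ∧ (ρ k : ℕ) < r).card : ℝ) + 1 := by exact_mod_cast h3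
          refine h4.trans ?_
          simpa [bt] using mh r
      · refine le_trans ?_ (le_max_left _ _)
        refine le_trans ?_ (le_max_left _ _)
        refine le_trans (card_mono ?_) (mh (r+1))
        intro i hi'
        simp only [Finset.mem_filter] at hi' ⊢
        refine ⟨hi'.1, ?_, hi'.2.2⟩
        by_contra hc
        exact h ⟨i, hi'.1, by omega, by omega⟩

lemma LL_iff {N : ℕ} (ρ : Equiv.Perm (Fin N)) (C : Finset (Fin N)) (x : ℝ) :
    x ≤ LL (ex2 (xiOf ρ C)) N N ↔ QQ ρ C x := by
  constructor
  · intro h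
    obtain ⟨s, a, b, c, d⟩ := LL_exists ρ C N N
    exact ⟨s, a, b, h.trans d⟩
  · rintro ⟨s, a, b, c⟩
    refine c.trans ?_
    have := LL_ge ρ C s a b N N
    rwa [Finset.filter_true_of_mem (by intro k _; exact ⟨k.2, (ρ k).2⟩)] at this

lemma pattern_aux {N n : ℕ} (D : Finset (Fin N)) (hD : D.card = n) (π : Equiv.Perm (Fin N)) :
    ∃ s : Equiv.Perm (Fin n), ∀ (τ : Equiv.Perm (Fin n)) (x : ℝ),
      QQ (π * τ.viaFintypeEmbedding (D.orderEmbOfFin hD).toEmbedding) D x ↔ x ≤ lis (s * τ) := by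
  set e := D.orderEmbOfFin hD with he
  have hE : (D.map π.toEmbedding).card = n := by simpa using hD
  set e' := (D.map π.toEmbedding).orderEmbOfFin hE with he'
  have hg : ∀ i, ∃ k, e' k = π (e i) := by
    intro i
    have : π (e i) ∈ Set.range e' := by
      rw [he', Finset.range_orderEmbOfFin]
      simp only [Finset.coe_map, Set.mem_image, Finset.mem_coe]
      exact ⟨e i, Finset.orderEmbOfFin_mem D hD i, rfl⟩
    exact this
  choose g hg using hg
  have ginj : Function.Injective g := by
    intro i j h
    have : π (e i) = π (e j) := by rw [← hg, ← hg, h]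
    exact e.injective (π.injective this)
  refine ⟨Equiv.ofBijective g (Finite.injective_iff_bijective.mp ginj), fun τ x => ?_⟩
  rw [le_lis]
  have val : ∀ i, (π * τ.viaFintypeEmbedding e.toEmbedding) (e i) = e' (g (τ i)) := by
    intro i
    have := Equiv.Perm.viaFintypeEmbedding_apply_image τ e.toEmbedding i
    rw [Equiv.Perm.mul_apply]
    change τ.viaFintypeEmbedding e.toEmbedding (e i) = e (τ i) at this
    rw [this, hg]
  have inc : ∀ t : Finset (Fin n), IncSeq (π * τ.viaFintypeEmbedding e.toEmbedding) (t.map e.toEmbedding) ↔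
      IncSeq (Equiv.ofBijective g (Finite.injective_iff_bijective.mp ginj) * τ) t := by
    intro t
    constructor
    · intro h i hi j hj hij
      have := h (e i) (Finset.mem_map_of_mem _ hi) (e j) (Finset.mem_map_of_mem _ hj) (e.lt_iff_lt.mpr hij)
      rw [val, val, e'.lt_iff_lt] at this
      exact this
    · intro h i hi j hj hij
      obtain ⟨i, hi2, rfl⟩ := Finset.mem_map.mp hi
      obtain ⟨j, hj2, rfl⟩ := Finset.mem_map.mp hj
      have := h i hi2 j hj2 (e.lt_iff_lt.mp hij)
      change (π * τ.viaFintypeEmbedding e.toEmbedding) (e i) < (π * τ.viaFintypeEmbedding e.toEmbedding) (e j)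
      rw [val, val, e'.lt_iff_lt]
      exact this
  constructor
  · rintro ⟨s, a, b, c⟩
    have : ∃ t : Finset (Fin n), t.map e.toEmbedding = s := by
      refine ⟨Finset.univ.filter (fun i => e i ∈ s), ?_⟩
      ext y
      simp only [Finset.mem_map, Finset.mem_filter, Finset.mem_univ, true_and]
      constructor
      · rintro ⟨i, hi, rfl⟩; exact hi
      · intro hy
        have : y ∈ Set.range e := by
          rw [he, Finset.range_orderEmbOfFin]; exact a hy
        obtain ⟨i, rfl⟩ := this
        exact ⟨i, hy, rfl⟩
    obtain ⟨t, rfl⟩ := this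
    exact ⟨t, (inc t).mp b, by simpa using c⟩
  · rintro ⟨t, b, c⟩
    refine ⟨t.map e.toEmbedding, ?_, (inc t).mpr b, by simpa using c⟩
    intro y hy
    obtain ⟨i, _, rfl⟩ := Finset.mem_map.mp hy
    exact Finset.orderEmbOfFin_mem D hD i

/-- probability under the uniform measure that `lis` is at least `x` -/
def UU (n : ℕ) (x : ℝ) : ℝ := (∑ σ : Equiv.Perm (Fin n), ind (x ≤ lis σ)) / (n.factorial : ℝ)

lemma pattern {N n : ℕ} (D : Finset (Fin N)) (hD : D.card = n) (x : ℝ) :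
    (∑ π : Equiv.Perm (Fin N), ind (QQ π D x)) / (N.factorial : ℝ) = UU n x := by
  unfold UU
  rw [div_eq_div_iff (by positivity) (by positivity)]
  have h1 : ∑ τ : Equiv.Perm (Fin n), ∑ π : Equiv.Perm (Fin N),
      ind (QQ (π * τ.viaFintypeEmbedding (D.orderEmbOfFin hD).toEmbedding) D x) =
      n.factorial * ∑ π : Equiv.Perm (Fin N), ind (QQ π D x) := by
    have : ∀ τ : Equiv.Perm (Fin n), ∑ π : Equiv.Perm (Fin N),
      ind (QQ (π * τ.viaFintypeEmbedding (D.orderEmbOfFin hD).toEmbedding) D x) = 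
      ∑ π : Equiv.Perm (Fin N), ind (QQ π D x) := fun τ =>
      Equiv.sum_comp (Equiv.mulRight (τ.viaFintypeEmbedding (D.orderEmbOfFin hD).toEmbedding))
        (fun π => ind (QQ π D x))
    simp only [this]
    simp [Fintype.card_perm]
  rw [Finset.sum_comm] at h1
  have h2 : ∀ π : Equiv.Perm (Fin N), ∑ τ : Equiv.Perm (Fin n),
      ind (QQ (π * τ.viaFintypeEmbedding (D.orderEmbOfFin hD).toEmbedding) D x) =
      ∑ σ : Equiv.Perm (Fin n), ind (x ≤ lis σ) := by
    intro π
    obtain ⟨s, hs⟩ := pattern_aux D hD π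
    simp only [hs]
    exact Equiv.sum_comp (Equiv.mulLeft s) (fun σ => ind (x ≤ lis σ))
  simp only [h2] at h1
  simp [Fintype.card_perm] at h1
  linarith


def GP {N : ℕ} (ξ : B2 N) : Prop :=
  ∀ c c' : Fin N × Fin N, ξ c = true → ξ c' = true → (c.1 = c'.1 ↔ c.2 = c'.2)

def KK {N : ℕ} (ξ : B2 N) : ℝ := ∑ c, bt (ξ c)

lemma KK_xiOf {N : ℕ} (ρ : Equiv.Perm (Fin N)) (C : Finset (Fin N)) : KK (xiOf ρ C) = C.card := by
  unfold KK xiOf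
  rw [Fintype.sum_prod_type]
  have : ∀ i : Fin N, ∑ j : Fin N, bt (decide (i ∈ C ∧ ρ i = j)) = if i ∈ C then 1 else 0 := by
    intro i
    by_cases h : i ∈ C <;> simp [h, bt]
  simp only [this]
  simp

lemma GP_xiOf {N : ℕ} (ξ : B2 N) (h : GP ξ) : ∃ ρ C, ξ = xiOf ρ C := by
  classical
  set C : Finset (Fin N) := Finset.univ.filter (fun i => ∃ j, ξ (i, j) = true) with hC
  set f : Fin N → Fin N := fun i => if hi : ∃ j, ξ (i, j) = true then hi.choose else i with hf
  have hfC : ∀ i ∈ C, ξ (i, f i) = true := by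
    intro i hi
    have hi' : ∃ j, ξ (i, j) = true := by simpa [hC] using hi
    simp only [hf, hi', dite_true]
    exact hi'.choose_spec
  have hinj : Set.InjOn f C := by
    intro i hi j hj hij
    exact (h (i, f i) (j, f j) (hfC i hi) (hfC j hj)).mpr hij
  obtain ⟨g, hg⟩ := Finset.exists_equiv_extend_of_card_eq (t := (Finset.univ : Finset (Fin N))) (by simp) (s := C)
    (f := f) (by simp) hinj
  refine ⟨g.trans (Equiv.subtypeUnivEquiv (by simp)), C, ?_⟩
  have hgC : ∀ i ∈ C, (g.trans (Equiv.subtypeUnivEquiv (by simp))) i = f i := fun i hi => hg i hi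
  funext c
  obtain ⟨i, j⟩ := c
  rw [Bool.eq_iff_iff]
  simp only [xiOf, decide_eq_true_eq]
  constructor
  · intro hc
    have hi : i ∈ C := by simp only [hC, Finset.mem_filter, Finset.mem_univ, true_and]; exact ⟨j, hc⟩
    refine ⟨hi, ?_⟩
    rw [hgC i hi]
    exact (h (i, f i) (i, j) (hfC i hi) hc).mp rfl
  · rintro ⟨hi, hj⟩
    rw [hgC i hi] at hj
    rw [← hj]; exact hfC i hi

lemma Ex_perm {ι : Type} [Fintype ι] [DecidableEq ι] (p : ℝ) (e : Equiv.Perm ι) (F : (ι → Bool) → ℝ) :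
    Ex (fun _ : ι => p) (fun x => F (fun c => x (e c))) = Ex (fun _ : ι => p) F := by
  unfold Ex
  have := Equiv.sum_comp (e.arrowCongr (Equiv.refl Bool)).symm (fun x : ι → Bool => (∏ i, wt p (x i)) * F x)
  rw [← this]
  refine Finset.sum_congr rfl fun x _ => ?_
  have h1 : (e.arrowCongr (Equiv.refl Bool)).symm x = fun c => x (e c) := by
    funext c; simp [Equiv.arrowCongr]
  rw [h1, Equiv.prod_comp e (fun i => wt p (x i))]

def AV {N : ℕ} (x : ℝ) (ξ : B2 N) : ℝ :=
  (∑ π : Equiv.Perm (Fin N), ind (x ≤ LL (ex2 (fun c : Fin N × Fin N => ξ (c.1, π c.2))) N N)) / (N.factorial : ℝ)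

lemma Ex_AV {N : ℕ} (p x : ℝ) : Ex (fun _ : Fin N × Fin N => p) (fun ξ => ind (x ≤ LL (ex2 ξ) N N)) =
    Ex (fun _ : Fin N × Fin N => p) (AV x) := by
  unfold AV
  rw [Ex_div, Ex_sum]
  have : ∀ π : Equiv.Perm (Fin N), Ex (fun _ : Fin N × Fin N => p)
      (fun ξ => ind (x ≤ LL (ex2 (fun c : Fin N × Fin N => ξ (c.1, π c.2))) N N)) =
      Ex (fun _ : Fin N × Fin N => p) (fun ξ => ind (x ≤ LL (ex2 ξ) N N)) := fun π =>
    Ex_perm p ((Equiv.refl (Fin N)).prodCongr π) (fun ξ => ind (x ≤ LL (ex2 ξ) N N))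
  simp only [this]
  simp only [Finset.sum_const, Finset.card_univ, Fintype.card_perm, Fintype.card_fin, nsmul_eq_mul]
  have : (N.factorial : ℝ) ≠ 0 := by positivity
  field_simp

lemma AV_xiOf {N : ℕ} (x : ℝ) (ρ : Equiv.Perm (Fin N)) (C : Finset (Fin N)) :
    AV x (xiOf ρ C) = (∑ π : Equiv.Perm (Fin N), ind (QQ π C x)) / (N.factorial : ℝ) := by
  unfold AV
  congr 1
  have h1 : ∀ π : Equiv.Perm (Fin N), (fun c : Fin N × Fin N => xiOf ρ C (c.1, π c.2)) = xiOf (π⁻¹ * ρ) C := by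
    intro π; funext c
    simp only [xiOf, Equiv.Perm.mul_apply]
    congr 1
    rw [Equiv.Perm.inv_eq_iff_eq]
  simp only [h1, LL_iff]
  have h2 := Equiv.sum_comp ((Equiv.inv (Equiv.Perm (Fin N))).trans (Equiv.mulRight ρ)) (fun π => ind (QQ π C x))
  exact h2

lemma QQ_mono {N : ℕ} {σ : Equiv.Perm (Fin N)} {C D : Finset (Fin N)} {x : ℝ} (h : C ⊆ D) (hQ : QQ σ C x) : QQ σ D x := by
  obtain ⟨s, a, b⟩ := hQ
  exact ⟨s, a.trans h, b⟩

lemma UU_nonneg (n : ℕ) (x : ℝ) : 0 ≤ UU n x :=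
  div_nonneg (Finset.sum_nonneg fun _ _ => ind_nonneg _) (by positivity)
lemma UU_le_one (n : ℕ) (x : ℝ) : UU n x ≤ 1 := by
  unfold UU
  rw [div_le_one (by positivity)]
  refine (Finset.sum_le_sum fun _ _ => ind_le_one _).trans ?_
  simp [Fintype.card_perm]
lemma AV_nonneg {N : ℕ} (ξ : B2 N) (x : ℝ) : 0 ≤ AV x ξ :=
  div_nonneg (Finset.sum_nonneg fun _ _ => ind_nonneg _) (by positivity)
lemma AV_le_one {N : ℕ} (ξ : B2 N) (x : ℝ) : AV x ξ ≤ 1 := by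
  unfold AV
  rw [div_le_one (by positivity)]
  refine (Finset.sum_le_sum fun _ _ => ind_le_one _).trans ?_
  simp [Fintype.card_perm]

lemma AV_upper {N n : ℕ} (hn : n ≤ N) (x : ℝ) (ξ : B2 N) :
    AV x ξ ≤ UU n x + ind (¬ GP ξ) + ind ((n : ℝ) < KK ξ) := by
  have a1 := UU_nonneg n x
  have a2 := ind_nonneg (¬ GP ξ)
  have a3 := ind_nonneg ((n : ℝ) < KK ξ)
  have a4 := AV_le_one ξ x
  by_cases h : GP ξ
  · by_cases hk : (n : ℝ) < KK ξ
    · rw [ind_true hk]; linarith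
    · obtain ⟨ρ, C, rfl⟩ := GP_xiOf ξ h
      rw [KK_xiOf] at hk
      have hk' : C.card ≤ n := by exact_mod_cast not_lt.mp hk
      obtain ⟨D, hCD, hD⟩ := Finset.exists_superset_card_eq hk' (by simpa using hn)
      have : AV x (xiOf ρ C) ≤ UU n x := by
        rw [AV_xiOf, ← pattern D hD]
        gcongr with π
        exact ind_mono (QQ_mono hCD)
      linarith
  · rw [ind_true h]; linarith

lemma AV_lower {N n : ℕ} (x : ℝ) (ξ : B2 N) :
    UU n x ≤ AV x ξ + ind (¬ GP ξ) + ind (KK ξ < n) := by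
  have a1 := AV_nonneg ξ x
  have a2 := ind_nonneg (¬ GP ξ)
  have a3 := ind_nonneg (KK ξ < (n : ℝ))
  have a4 := UU_le_one n x
  by_cases h : GP ξ
  · by_cases hk : KK ξ < (n : ℝ)
    · rw [ind_true hk]; linarith
    · obtain ⟨ρ, C, rfl⟩ := GP_xiOf ξ h
      rw [KK_xiOf] at hk
      have hk' : n ≤ C.card := by exact_mod_cast not_lt.mp hk
      obtain ⟨D, hCD, hD⟩ := Finset.exists_subset_card_eq hk'
      have : UU n x ≤ AV x (xiOf ρ C) := by
        rw [AV_xiOf, ← pattern D hD]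
        gcongr with π
        exact ind_mono (QQ_mono hCD)
      linarith
  · rw [ind_true h]; linarith

lemma Ex_pair {ι : Type} [Fintype ι] [DecidableEq ι] (p : ℝ) {c c' : ι} (h : c ≠ c') :
    Ex (fun _ : ι => p) (fun x => bt (x c) * bt (x c')) = p ^ 2 := by
  rw [Ex_resample c, Ex_resample c', ← Ex_const (q := fun _ : ι => p) (p ^ 2)]
  refine Ex_congr fun x => ?_
  simp [Function.update_of_ne h, Function.update_of_ne h.symm, bt]
  ring

lemma bt_nonneg' (b : Bool) : 0 ≤ bt b := by cases b <;> simp [bt]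

lemma NG_le {N : ℕ} {p : ℝ} (h0 : 0 ≤ p) (h1 : p ≤ 1) :
    Ex (fun _ : Fin N × Fin N => p) (fun ξ => ind (¬ GP ξ)) ≤ 2 * (N : ℝ) ^ 3 * p ^ 2 := by
  set T : (Fin N × Fin N) × Fin N → B2 N → ℝ := fun d ξ =>
    (if d.2 = d.1.2 then 0 else bt (ξ d.1) * bt (ξ (d.1.1, d.2))) +
    (if d.2 = d.1.1 then 0 else bt (ξ d.1) * bt (ξ (d.2, d.1.2))) with hT
  have hT0 : ∀ d ξ, 0 ≤ T d ξ := by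
    intro d ξ
    simp only [hT]
    have := bt_nonneg' (ξ d.1)
    have := bt_nonneg' (ξ (d.1.1, d.2))
    have := bt_nonneg' (ξ (d.2, d.1.2))
    split_ifs <;> positivity
  have hle : ∀ ξ : B2 N, ind (¬ GP ξ) ≤ ∑ d, T d ξ := by
    intro ξ
    by_cases h : GP ξ
    · rw [ind_false (by simpa using h)]
      exact Finset.sum_nonneg fun d _ => hT0 d ξ
    · rw [ind_true h]
      unfold GP at h
      push Not at h
      obtain ⟨⟨i, j⟩, ⟨i', j'⟩, hc, hc', h⟩ := h
      have key : ∀ d, 1 ≤ T d ξ → 1 ≤ ∑ d, T d ξ := fun d hd =>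
        hd.trans (Finset.single_le_sum (fun d _ => hT0 d ξ) (Finset.mem_univ d))
      rcases h with ⟨h, h'⟩ | ⟨h, h'⟩
      · simp only at h h'
        subst h
        apply key ((i, j), j')
        simp only [hT, hc, hc', if_neg (Ne.symm h')]
        simp only [bt, if_true, mul_one, one_mul, le_add_iff_nonneg_right]
        split_ifs <;> norm_num
      · simp only at h h'
        subst h'
        apply key ((i, j), i')
        simp only [hT, hc, hc', if_neg (Ne.symm h)]
        simp only [bt, if_true, mul_one, one_mul, le_add_iff_nonneg_left]
        split_ifs <;> norm_num
  refine (Ex_mono (fun _ => h0) (fun _ => h1) hle).trans ?_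
  rw [Ex_sum]
  have hb : ∀ d ∈ (Finset.univ : Finset ((Fin N × Fin N) × Fin N)), Ex (fun _ : Fin N × Fin N => p) (T d) ≤ 2 * p ^ 2 := by
    rintro ⟨⟨i, j⟩, k⟩ -
    simp only [hT]
    rw [Ex_add]
    have e1 : Ex (fun _ : Fin N × Fin N => p) (fun ξ => if k = j then (0:ℝ) else bt (ξ (i, j)) * bt (ξ (i, k))) ≤ p ^ 2 := by
      by_cases hk : k = j
      · simp only [if_pos hk, Ex_const]; positivity
      · simp only [if_neg hk]
        rw [Ex_pair p (by simpa using Ne.symm hk)]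
    have e2 : Ex (fun _ : Fin N × Fin N => p) (fun ξ => if k = i then (0:ℝ) else bt (ξ (i, j)) * bt (ξ (k, j))) ≤ p ^ 2 := by
      by_cases hk : k = i
      · simp only [if_pos hk, Ex_const]; positivity
      · simp only [if_neg hk]
        rw [Ex_pair p (by simpa using Ne.symm hk)]
    linarith
  refine (Finset.sum_le_card_nsmul _ _ _ hb).trans (le_of_eq ?_)
  simp
  ring

lemma KK_var {N : ℕ} (hN : 1 ≤ N) {s e : ℝ} (hs : 0 < s) (hsN : s ≤ N) (he : 0 < e) :
    Ex (fun _ : Fin N × Fin N => (s / N) ^ 2) (fun ξ => ind (e ≤ |KK ξ - s ^ 2|)) ≤ s ^ 2 / e ^ 2 := by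
  have hN' : (0:ℝ) < N := by exact_mod_cast hN
  have hp0 : 0 ≤ (s / N) ^ 2 := by positivity
  have hp1 : (s / N) ^ 2 ≤ 1 := pow_le_one₀ (by positivity) ((div_le_one hN').mpr hsN)
  have h1 : ∀ ξ : B2 N, ind (e ≤ |KK ξ - s ^ 2|) ≤ (KK ξ - s ^ 2) ^ 2 / e ^ 2 := by
    intro ξ
    by_cases h : e ≤ |KK ξ - s ^ 2|
    · rw [ind_true h]; exact cheb he h
    · rw [ind_false h]; positivity
  refine (Ex_mono (fun _ => hp0) (fun _ => hp1) h1).trans ?_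
  rw [Ex_div]
  gcongr
  have h2 := Ex_var (q := fun _ : Fin N × Fin N => (s / N) ^ 2) Finset.univ
  have h3 : ∀ ξ : B2 N, ∑ c, (bt (ξ c) - (s / N) ^ 2) = KK ξ - s ^ 2 := by
    intro ξ
    rw [Finset.sum_sub_distrib]
    simp only [KK, Finset.sum_const, Finset.card_univ, Fintype.card_prod, Fintype.card_fin, nsmul_eq_mul]
    congr 1; push_cast; field_simp
  simp only [h3] at h2
  rw [h2]
  simp only [Finset.sum_const, Finset.card_univ, Fintype.card_prod, Fintype.card_fin, nsmul_eq_mul]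
  push_cast
  have : (N:ℝ) * N * ((s / N) ^ 2 * (1 - (s / N) ^ 2)) = s ^ 2 * (1 - (s / N) ^ 2) := by field_simp
  rw [this]
  nlinarith [sq_nonneg s]

lemma UU_upper {N n : ℕ} (hN : 1 ≤ N) {s ε : ℝ} (hs : 0 < s) (hsN : s ≤ N) (hε : 0 < ε) (hn : (n:ℝ) < s ^ 2) :
    UU n ((2 + ε) * s) ≤ 8 / (ε ^ 2 * s) + 2 * s ^ 4 / N + s ^ 2 / (s ^ 2 - n) ^ 2 := by
  have hN' : (0:ℝ) < N := by exact_mod_cast hN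
  have hp0 : 0 ≤ (s / N) ^ 2 := by positivity
  have hp1 : (s / N) ^ 2 ≤ 1 := pow_le_one₀ (by positivity) ((div_le_one hN').mpr hsN)
  have h1 := Ex_mono (q := fun _ : Fin N × Fin N => (s / N) ^ 2) (fun _ => hp0) (fun _ => hp1)
    (AV_lower (n := n) ((2 + ε) * s))
  rw [Ex_const, Ex_add, Ex_add, ← Ex_AV] at h1
  have h2 := LL_upper hN hs hsN hε
  have h3 := NG_le (N := N) hp0 hp1
  have h4 := KK_var hN hs hsN (sub_pos.mpr hn)
  have h5 : Ex (fun _ : Fin N × Fin N => (s / N) ^ 2) (fun ξ => ind (KK ξ < n)) ≤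
    Ex (fun _ : Fin N × Fin N => (s / N) ^ 2) (fun ξ => ind (s ^ 2 - n ≤ |KK ξ - s ^ 2|)) := by
    refine Ex_mono (fun _ => hp0) (fun _ => hp1) fun ξ => ind_mono fun h => ?_
    rw [abs_sub_comm]
    exact le_trans (by linarith) (le_abs_self _)
  have h6 : 2 * (N:ℝ) ^ 3 * ((s / N) ^ 2) ^ 2 = 2 * s ^ 4 / N := by field_simp
  rw [h6] at h3
  linarith only [h1, h2, h3, h4, h5]

lemma UU_lower {N n : ℕ} (hN : 1 ≤ N) (hnN : n ≤ N) {s δ ε : ℝ} (hs : 0 < s) (hsN : s ≤ N) (hδ : 0 < δ) (hδ1 : δ ≤ 1)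
    (hε : ε = δ ^ 2 / 100) (g1 : 4 * (s / N) ≤ ε) (g2 : 1 ≤ ε * s) (hn : s ^ 2 < n) :
    1 - UU n ((2 - 3 * δ) * s) ≤ 20 / (ε ^ 2 * s) + 2 * s ^ 4 / N + s ^ 2 / (n - s ^ 2) ^ 2 := by
  have hN' : (0:ℝ) < N := by exact_mod_cast hN
  have hp0 : 0 ≤ (s / N) ^ 2 := by positivity
  have hp1 : (s / N) ^ 2 ≤ 1 := pow_le_one₀ (by positivity) ((div_le_one hN').mpr hsN)
  have h1 := Ex_mono (q := fun _ : Fin N × Fin N => (s / N) ^ 2) (fun _ => hp0) (fun _ => hp1)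
    (AV_upper hnN ((2 - 3 * δ) * s))
  rw [Ex_add, Ex_add, Ex_const] at h1
  change Ex _ (AV _) ≤ _ at h1
  rw [← Ex_AV] at h1
  have h2 := LL_lower hN hs hsN hδ hδ1 hε g1 g2
  have h3 := NG_le (N := N) hp0 hp1
  have h4 := KK_var hN hs hsN (sub_pos.mpr hn)
  have h5 : Ex (fun _ : Fin N × Fin N => (s / N) ^ 2) (fun ξ => ind ((n:ℝ) < KK ξ)) ≤
    Ex (fun _ : Fin N × Fin N => (s / N) ^ 2) (fun ξ => ind (n - s ^ 2 ≤ |KK ξ - s ^ 2|)) := by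
    refine Ex_mono (fun _ => hp0) (fun _ => hp1) fun ξ => ind_mono fun h => ?_
    exact le_trans (by linarith) (le_abs_self _)
  have h6 : 2 * (N:ℝ) ^ 3 * ((s / N) ^ 2) ^ 2 = 2 * s ^ 4 / N := by field_simp
  rw [h6] at h3
  have h7 : (1:ℝ) ≤ Ex (fun _ : Fin N × Fin N => (s / N) ^ 2) (fun ξ => ind ((2 - 3 * δ) * s ≤ LL (ex2 ξ) N N)) +
      Ex (fun _ : Fin N × Fin N => (s / N) ^ 2) (fun ξ => ind (LL (ex2 ξ) N N < (2 - 3 * δ) * s)) := by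
    rw [← Ex_add]
    refine (Ex_const (q := fun _ : Fin N × Fin N => (s / N) ^ 2) 1).symm.le.trans (Ex_mono (fun _ => hp0) (fun _ => hp1) fun ξ => ?_)
    rcases le_or_gt ((2 - 3 * δ) * s) (LL (ex2 ξ) N N) with h | h
    · rw [ind_true h]; linarith [ind_nonneg (LL (ex2 ξ) N N < (2 - 3 * δ) * s)]
    · rw [ind_true h]; linarith [ind_nonneg ((2 - 3 * δ) * s ≤ LL (ex2 ξ) N N)]
  linarith only [h1, h2, h3, h4, h5, h7]


lemma sqrt_nat_tendsto : Filter.Tendsto (fun n : ℕ => Real.sqrt n) Filter.atTop Filter.atTop :=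
  Real.tendsto_sqrt_atTop.comp tendsto_natCast_atTop_atTop

lemma err_tendsto (a b c : ℝ) :
    Filter.Tendsto (fun n : ℕ => a / Real.sqrt n + b / n + c / n) Filter.atTop (nhds 0) := by
  have h1 : Filter.Tendsto (fun n : ℕ => a / Real.sqrt n) Filter.atTop (nhds 0) :=
    sqrt_nat_tendsto.const_div_atTop a
  have h2 := tendsto_const_div_atTop_nhds_zero_nat b
  have h3 := tendsto_const_div_atTop_nhds_zero_nat c
  simpa using (h1.add h2).add h3

lemma UU_tendsto_upper {ε : ℝ} (hε : 0 < ε) :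
    Filter.Tendsto (fun n : ℕ => UU n ((2 + ε) * Real.sqrt n)) Filter.atTop (nhds 0) := by
  set κ := (2 + ε) / (2 + ε / 2) with hκ
  have hκ1 : 1 < κ := by rw [hκ, lt_div_iff₀ (by positivity)]; linarith
  have hκ2 : κ ≤ 2 := by rw [hκ, div_le_iff₀ (by positivity)]; linarith
  have hk : (2 + ε / 2) * κ = 2 + ε := by rw [hκ]; field_simp
  clear_value κ
  refine tendsto_of_tendsto_of_tendsto_of_le_of_le' tendsto_const_nhds
    (err_tendsto (8 / ((ε / 2) ^ 2 * κ)) (2 * κ ^ 4) (κ ^ 2 / (κ ^ 2 - 1) ^ 2))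
    (Filter.Eventually.of_forall fun n => UU_nonneg n _) ?_
  filter_upwards [Filter.eventually_ge_atTop 4] with n hn
  have hn' : (4:ℝ) ≤ n := by exact_mod_cast hn
  set t := Real.sqrt n with ht
  have ht2 : t ^ 2 = n := Real.sq_sqrt (by positivity)
  have ht0 : 2 ≤ t := by
    rw [ht]; exact Real.le_sqrt_of_sq_le (by linarith)
  have hκ0 : 0 < κ := by linarith
  have hκs : 1 < κ ^ 2 := by nlinarith only [hκ1]
  have tn : t ≤ n / 2 := by rw [← ht2]; nlinarith only [ht0]
  have nn : (n:ℝ) ≤ (n:ℝ) ^ 3 := le_self_pow₀ (by linarith) (by norm_num)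
  have hsN : κ * t ≤ ((n ^ 3 : ℕ) : ℝ) := by
    push_cast
    calc κ * t ≤ 2 * (n / 2) := by gcongr
      _ ≤ _ := by linarith
  have := UU_upper (N := n ^ 3) (n := n) (Nat.one_le_pow _ _ (by omega)) (s := κ * t) (ε := ε / 2)
    (by positivity) hsN (by positivity) (by rw [mul_pow, ht2]; nlinarith only [hκs, hn'])
  have e1 : (2 + ε / 2) * (κ * t) = (2 + ε) * t := by rw [← mul_assoc, hk]
  rw [e1] at this
  refine this.trans (le_of_eq ?_)
  push_cast
  rw [← ht2]
  have : κ ^ 2 - 1 ≠ 0 := by linarith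
  have e2 : (κ * t) ^ 2 - t ^ 2 = (κ ^ 2 - 1) * t ^ 2 := by ring
  rw [e2]
  have t0 : t ≠ 0 := by linarith
  field_simp

lemma UU_tendsto_lower {ε : ℝ} (hε : 0 < ε) (hε2 : ε < 2) :
    Filter.Tendsto (fun n : ℕ => 1 - UU n ((2 - ε) * Real.sqrt n)) Filter.atTop (nhds 0) := by
  set κ := (2 - ε) / (2 - ε / 2) with hκ
  have hκ0 : 0 < κ := by rw [hκ]; apply div_pos <;> linarith
  have hκ1 : κ < 1 := by rw [hκ, div_lt_one (by linarith)]; linarith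
  have hk : (2 - 3 * (ε / 6)) * κ = 2 - ε := by
    have : 2 - ε / 2 ≠ 0 := by linarith
    have e : 2 - 3 * (ε / 6) = 2 - ε / 2 := by ring
    rw [hκ, e]; exact mul_div_cancel₀ _ this
  clear_value κ
  set η := (ε / 6) ^ 2 / 100 with hη
  have hη0 : 0 < η := by positivity
  refine tendsto_of_tendsto_of_tendsto_of_le_of_le' tendsto_const_nhds
    (err_tendsto (20 / (η ^ 2 * κ)) (2 * κ ^ 4) (κ ^ 2 / (1 - κ ^ 2) ^ 2))
    (Filter.Eventually.of_forall fun n => sub_nonneg.mpr (UU_le_one n _)) ?_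
  filter_upwards [Filter.eventually_ge_atTop 4, tendsto_natCast_atTop_atTop.eventually_ge_atTop (4 / η),
    sqrt_nat_tendsto.eventually_ge_atTop (1 / (η * κ))] with n hn hn2 hn3
  have hn' : (4:ℝ) ≤ n := by exact_mod_cast hn
  set t := Real.sqrt n with ht
  have ht2 : t ^ 2 = n := Real.sq_sqrt (by positivity)
  have ht0 : 2 ≤ t := by
    rw [ht]; exact Real.le_sqrt_of_sq_le (by linarith)
  have hκs : κ ^ 2 < 1 := by nlinarith only [hκ1, hκ0]
  have tn : t ≤ n / 2 := by rw [← ht2]; nlinarith only [ht0]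
  have nn : (n:ℝ) ^ 2 ≤ (n:ℝ) ^ 3 := pow_le_pow_right₀ (by linarith) (by norm_num)
  have hs1 : κ * t ≤ n := by
    calc κ * t ≤ 1 * (n / 2) := by gcongr
      _ ≤ _ := by linarith
  have hN1 : n ≤ n ^ 3 := Nat.le_self_pow (by norm_num) n
  have hsN : κ * t ≤ ((n ^ 3 : ℕ) : ℝ) := hs1.trans (by exact_mod_cast hN1)
  rw [div_le_iff₀ (by positivity)] at hn2 hn3
  have := UU_lower (N := n ^ 3) (n := n) (Nat.one_le_pow _ _ (by omega)) hN1 (s := κ * t) (δ := ε / 6) (ε := η)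
    (by positivity) hsN (by positivity) (by linarith) rfl
    (by
      push_cast
      rw [← mul_div_assoc, div_le_iff₀ (by positivity)]
      calc 4 * (κ * t) ≤ 4 * n := by gcongr
        _ ≤ (n * η) * n := by gcongr
        _ = η * n ^ 2 := by ring
        _ ≤ _ := by gcongr)
    (by linarith only [hn3])
    (by rw [mul_pow, ht2]; nlinarith only [hκs, hn'])
  have e1 : (2 - 3 * (ε / 6)) * (κ * t) = (2 - ε) * t := by rw [← mul_assoc, hk]
  rw [e1] at this
  refine this.trans (le_of_eq ?_)
  push_cast
  rw [← ht2]
  have : 1 - κ ^ 2 ≠ 0 := by linarith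
  have e2 : t ^ 2 - (κ * t) ^ 2 = (1 - κ ^ 2) * t ^ 2 := by ring
  rw [e2]
  have t0 : t ≠ 0 := by linarith
  field_simp

/-- uniform probability -/
def PU (n : ℕ) (P : Equiv.Perm (Fin n) → Prop) : ℝ := (∑ σ, ind (P σ)) / (n.factorial : ℝ)

lemma PU_nonneg (n : ℕ) (P : Equiv.Perm (Fin n) → Prop) : 0 ≤ PU n P :=
  div_nonneg (Finset.sum_nonneg fun _ _ => ind_nonneg _) (by positivity)

lemma PU_mono {n : ℕ} {P Q : Equiv.Perm (Fin n) → Prop} (h : ∀ σ, P σ → Q σ) : PU n P ≤ PU n Q := by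
  unfold PU
  gcongr with σ
  exact ind_mono (h σ)

lemma PU_lis {ε : ℝ} (hε : 0 < ε) :
    Filter.Tendsto (fun n : ℕ => PU n (fun σ => ε < |(lis σ : ℝ) / Real.sqrt n - 2|)) Filter.atTop (nhds 0) := by
  wlog h2 : ε < 2 generalizing ε
  · have := this (ε := 1) (by norm_num) (by norm_num)
    refine tendsto_of_tendsto_of_tendsto_of_le_of_le tendsto_const_nhds this
      (fun n => PU_nonneg n _) (fun n => PU_mono fun σ h => ?_)
    linarith
  have h1 := (UU_tendsto_upper hε).add (UU_tendsto_lower hε h2)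
  rw [add_zero] at h1
  refine tendsto_of_tendsto_of_tendsto_of_le_of_le' tendsto_const_nhds h1
      (Filter.Eventually.of_forall fun n => PU_nonneg n _) ?_
  filter_upwards [Filter.eventually_ge_atTop 1] with n hn
  have ht : 0 < Real.sqrt n := Real.sqrt_pos.mpr (by exact_mod_cast hn)
  set t := Real.sqrt n
  have hf : (n.factorial : ℝ) = ∑ σ : Equiv.Perm (Fin n), (1:ℝ) := by simp [Fintype.card_perm]
  have h0 : (0:ℝ) < n.factorial := by positivity
  have h3 : 1 - UU n ((2 - ε) * t) = (∑ σ : Equiv.Perm (Fin n), (1 - ind ((2 - ε) * t ≤ lis σ))) / n.factorial := by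
    rw [Finset.sum_sub_distrib, ← hf, sub_div, div_self h0.ne']; rfl
  rw [h3]
  unfold PU UU
  rw [← add_div, ← Finset.sum_add_distrib]
  gcongr with σ
  by_cases h : ε < |(lis σ : ℝ) / t - 2|
  · rw [ind_true h]
    rcases lt_abs.mp h with h | h
    · have : (2 + ε) * t ≤ lis σ := by rw [← le_div_iff₀ ht]; linarith
      rw [ind_true this]; linarith [ind_le_one ((2 - ε) * t ≤ lis σ)]
    · have : ¬ (2 - ε) * t ≤ lis σ := by rw [← le_div_iff₀ ht]; linarith
      rw [ind_false this]; linarith [ind_nonneg ((2 + ε) * t ≤ lis σ)]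
  · rw [ind_false h]
    linarith [ind_le_one ((2 - ε) * t ≤ lis σ), ind_nonneg ((2 + ε) * t ≤ lis σ)]

lemma lds_rev {n : ℕ} (σ : Equiv.Perm (Fin n)) : lis (Fin.revPerm * σ) = lds σ := by
  unfold lis lds
  congr 1
  ext k
  have : ∀ s, IncSeq (Fin.revPerm * σ) s ↔ DecSeq σ s := by
    intro s
    unfold IncSeq DecSeq
    simp [Equiv.Perm.mul_apply]
  simp only [this]

lemma PU_lds {ε : ℝ} (hε : 0 < ε) :
    Filter.Tendsto (fun n : ℕ => PU n (fun σ => ε < |(lds σ : ℝ) / Real.sqrt n - 2|)) Filter.atTop (nhds 0) := by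
  have : ∀ n : ℕ, PU n (fun σ => ε < |(lds σ : ℝ) / Real.sqrt n - 2|) = 
    PU n (fun σ => ε < |(lis σ : ℝ) / Real.sqrt n - 2|) := by
    intro n
    unfold PU
    simp only [← lds_rev]
    congr 1
    exact Equiv.sum_comp (Equiv.mulLeft Fin.revPerm) (fun σ : Equiv.Perm (Fin n) => ind (ε < |(lis σ : ℝ) / Real.sqrt n - 2|))
  simp only [this]
  exact PU_lis hε

open Equiv.Perm (SameCycle)

/-- number of orbits -/
def Qc {n : ℕ} (σ : Equiv.Perm (Fin n)) : ℕ := Nat.card (Quotient (SameCycle.setoid σ))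

lemma same_step {n m : ℕ} {σ : Equiv.Perm (Fin n)} {τ : Equiv.Perm (Fin m)} (f : Fin n → Fin m)
    (h : ∀ x, SameCycle τ (f x) (f (σ x))) {x y : Fin n} (hxy : SameCycle σ x y) : SameCycle τ (f x) (f y) := by
  obtain ⟨i, rfl⟩ := hxy.exists_nat_pow_eq
  clear hxy
  induction i with
  | zero => exact SameCycle.refl _ _
  | succ i ih =>
    rw [pow_succ', Equiv.Perm.mul_apply]
    exact ih.trans (h _)

lemma Qc_le_numCycles {n : ℕ} (σ : Equiv.Perm (Fin n)) : Qc σ ≤ numCycles σ := by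
  classical
  have hcard : numCycles σ = Nat.card (σ.cycleFactorsFinset ⊕ {x // σ x = x}) := by
    rw [Nat.card_sum]
    unfold numCycles
    congr 1
    · simp [Equiv.Perm.cycleType_def]
    · simp [Fintype.card_subtype]
  rw [hcard]
  unfold Qc
  let F : Quotient (SameCycle.setoid σ) → σ.cycleFactorsFinset ⊕ {x // σ x = x} := fun q =>
    if h : σ q.out = q.out then Sum.inr ⟨q.out, h⟩ else
      Sum.inl ⟨σ.cycleOf q.out, by
        rw [Equiv.Perm.cycleOf_mem_cycleFactorsFinset_iff, Equiv.Perm.mem_support]; exact h⟩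
  refine Nat.card_le_card_of_injective F ?_
  intro q r h
  rw [← q.out_eq, ← r.out_eq]
  by_cases hq : σ q.out = q.out <;> by_cases hr : σ r.out = r.out <;>
    simp only [F, hq, hr, dite_true, dite_false, Sum.inr.injEq, Sum.inl.injEq, Subtype.mk.injEq, reduceCtorEq] at h
  · rw [h]
  · apply Quotient.sound
    change SameCycle σ q.out r.out
    have : r.out ∈ (σ.cycleOf r.out).support := by
      rw [Equiv.Perm.mem_support_cycleOf_iff]; exact ⟨SameCycle.refl _ _, Equiv.Perm.mem_support.mpr hr⟩
    rw [← h, Equiv.Perm.mem_support_cycleOf_iff] at this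
    exact this.1

lemma Qc_zero_le {n : ℕ} (e : Equiv.Perm (Fin n)) : Qc (Equiv.Perm.decomposeFin.symm (0, e)) ≤ Qc e + 1 := by
  classical
  set τ := Equiv.Perm.decomposeFin.symm (0, e) with hτ
  have hs : ∀ x, SameCycle τ (Fin.succ x) (Fin.succ (e x)) := by
    intro x
    refine ⟨1, ?_⟩
    rw [zpow_one, hτ, Equiv.Perm.decomposeFin_symm_apply_succ]; simp
  unfold Qc
  rw [← Finite.card_option]
  let F : Option (Quotient (SameCycle.setoid e)) → Quotient (SameCycle.setoid τ) := fun o =>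
    o.elim (Quotient.mk _ 0) (Quotient.map' Fin.succ (fun x y h => same_step Fin.succ hs h))
  refine Nat.card_le_card_of_surjective F ?_
  intro q
  induction q using Quotient.inductionOn with
  | h x =>
    refine Fin.cases ?_ (fun i => ?_) x
    · exact ⟨none, rfl⟩
    · exact ⟨some (Quotient.mk _ i), rfl⟩

lemma Qc_succ_le {n : ℕ} (e : Equiv.Perm (Fin n)) (p : Fin (n + 1)) (hp : p ≠ 0) :
    Qc (Equiv.Perm.decomposeFin.symm (p, e)) ≤ Qc e := by
  classical
  set τ := Equiv.Perm.decomposeFin.symm (p, e) with hτ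
  have h0 : τ 0 = p := by rw [hτ, Equiv.Perm.decomposeFin_symm_apply_zero]
  have hs : ∀ x, SameCycle τ (Fin.succ x) (Fin.succ (e x)) := by
    intro x
    have h1 : τ x.succ = Equiv.swap 0 p (e x).succ := by rw [hτ, Equiv.Perm.decomposeFin_symm_apply_succ]
    by_cases h : (e x).succ = p
    · rw [h, Equiv.swap_apply_right] at h1
      refine ⟨2, ?_⟩
      rw [zpow_ofNat, pow_two, Equiv.Perm.mul_apply, h1, h0, h]
    · rw [Equiv.swap_apply_of_ne_of_ne (Fin.succ_ne_zero _) h] at h1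
      exact ⟨1, by rw [zpow_one, h1]⟩
  unfold Qc
  let F : Quotient (SameCycle.setoid e) → Quotient (SameCycle.setoid τ) :=
    (Quotient.map' Fin.succ (fun x y h => same_step Fin.succ hs h))
  refine Nat.card_le_card_of_surjective F ?_
  intro q
  induction q using Quotient.inductionOn with
  | h x =>
    refine Fin.cases ?_ (fun i => ?_) x
    · refine ⟨Quotient.mk _ (p.pred hp), ?_⟩
      refine Quotient.sound (?_ : SameCycle τ (p.pred hp).succ 0)
      rw [Fin.succ_pred]
      refine SameCycle.symm ⟨1, by rw [zpow_one, h0]⟩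
    · exact ⟨Quotient.mk _ i, rfl⟩

lemma sum_Qc (n : ℕ) : (∑ σ : Equiv.Perm (Fin n), (Qc σ : ℝ)) ≤ n.factorial * (harmonic n : ℝ) := by
  induction n with
  | zero => simp [Qc]
  | succ n ih =>
    rw [← Equiv.sum_comp Equiv.Perm.decomposeFin.symm, Fintype.sum_prod_type, Fin.sum_univ_succ]
    have h1 : ∑ e : Equiv.Perm (Fin n), (Qc (Equiv.Perm.decomposeFin.symm (0, e)) : ℝ) ≤
        n.factorial * (harmonic n : ℝ) + n.factorial := by
      calc _ ≤ ∑ e : Equiv.Perm (Fin n), ((Qc e : ℝ) + 1) :=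
            Finset.sum_le_sum fun e _ => by exact_mod_cast Qc_zero_le e
        _ = (∑ e : Equiv.Perm (Fin n), (Qc e : ℝ)) + n.factorial := by
            rw [Finset.sum_add_distrib]; simp [Fintype.card_perm]
        _ ≤ _ := by linarith
    have h2 : ∑ i : Fin n, ∑ e : Equiv.Perm (Fin n), (Qc (Equiv.Perm.decomposeFin.symm (i.succ, e)) : ℝ) ≤
        n * (n.factorial * (harmonic n : ℝ)) := by
      calc _ ≤ ∑ i : Fin n, (n.factorial * (harmonic n : ℝ)) := by
            refine Finset.sum_le_sum fun i _ => le_trans (Finset.sum_le_sum fun e _ => ?_) ih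
            exact_mod_cast Qc_succ_le e i.succ (Fin.succ_ne_zero i)
        _ = _ := by simp
    refine (add_le_add h1 h2).trans (le_of_eq ?_)
    rw [harmonic_succ, Nat.factorial_succ]
    push_cast
    field_simp
    ring

/-- Hamming distance -/
def DD {n : ℕ} (σ τ : Equiv.Perm (Fin n)) : ℕ := (Finset.univ.filter fun x => σ x ≠ τ x).card

lemma DD_triangle {n : ℕ} (σ τ υ : Equiv.Perm (Fin n)) : DD σ υ ≤ DD σ τ + DD τ υ := by
  unfold DD
  refine le_trans (Finset.card_le_card ?_) (Finset.card_union_le _ _)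
  intro x
  simp only [Finset.mem_filter, Finset.mem_univ, true_and, Finset.mem_union]
  intro h
  by_contra hc
  push Not at hc
  exact h (hc.1.trans hc.2)

lemma DD_comm {n : ℕ} (σ τ : Equiv.Perm (Fin n)) : DD σ τ = DD τ σ := by
  unfold DD; simp only [ne_comm]

lemma DD_self {n : ℕ} (σ : Equiv.Perm (Fin n)) : DD σ σ = 0 := by simp [DD]

lemma DD_conj {n : ℕ} (σ τ ρ : Equiv.Perm (Fin n)) : DD (ρ⁻¹ * σ * ρ) (ρ⁻¹ * τ * ρ) = DD σ τ := by
  unfold DD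
  refine Finset.card_bij (fun x _ => ρ x) ?_ ?_ ?_
  · intro x hx; simpa using hx
  · intro x _ y _ h; exact ρ.injective h
  · intro y hy
    refine ⟨ρ⁻¹ y, ?_, by simp⟩
    simpa using hy

lemma DD_swap {n : ℕ} (σ : Equiv.Perm (Fin n)) (x y : Fin n) : DD σ (σ * Equiv.swap x y) ≤ 2 := by
  unfold DD
  refine le_trans (Finset.card_le_card (t := {x, y}) ?_) Finset.card_le_two
  intro z
  simp only [Finset.mem_filter, Finset.mem_univ, true_and, Finset.mem_insert, Finset.mem_singleton]
  intro h
  by_contra hc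
  push Not at hc
  apply h
  rw [Equiv.Perm.mul_apply, Equiv.swap_apply_of_ne_of_ne hc.1 hc.2]

lemma Qc_merge {n : ℕ} (σ : Equiv.Perm (Fin n)) (x y : Fin n) (h : ¬ SameCycle σ x y) :
    Qc (σ * Equiv.swap x y) < Qc σ := by
  classical
  set τ := σ * Equiv.swap x y with hτ
  have tx : τ x = σ y := by simp [hτ]
  have ty : τ y = σ x := by simp [hτ]
  have tz : ∀ z, z ≠ x → z ≠ y → τ z = σ z := by
    intro z h1 h2; rw [hτ, Equiv.Perm.mul_apply, Equiv.swap_apply_of_ne_of_ne h1 h2]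
  have step : ∀ z, SameCycle τ z (τ z) := fun z => ⟨1, by simp⟩
  have hk : ∀ k : ℕ, SameCycle τ x ((σ ^ (k + 1)) y) := by
    intro k
    induction k with
    | zero => rw [zero_add, pow_one, ← tx]; exact step x
    | succ k ih =>
      rw [pow_succ', Equiv.Perm.mul_apply]
      set w := (σ ^ (k + 1)) y with hw
      by_cases h1 : w = y
      · rw [h1, ← tx]; exact step x
      · by_cases h2 : w = x
        · exact absurd (SameCycle.symm ⟨(k + 1 : ℕ), by rw [zpow_natCast, ← hw, h2]⟩) h
        · rw [← tz w h2 h1]; exact ih.trans (step w)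
  have hxy : SameCycle τ x y := by
    have h1 := orderOf_pos σ
    have := hk (orderOf σ - 1)
    rwa [Nat.sub_add_cancel h1, pow_orderOf_eq_one] at this
  have hs : ∀ z, SameCycle τ (id z) (id (σ z)) := by
    intro z
    simp only [id]
    by_cases h1 : z = x
    · rw [h1, ← ty]; exact hxy.trans (step y)
    · by_cases h2 : z = y
      · rw [h2, ← tx]; exact hxy.symm.trans (step x)
      · rw [← tz z h1 h2]; exact step z
  let F : Quotient (SameCycle.setoid σ) → Quotient (SameCycle.setoid τ) :=
    (Quotient.map' id (fun x y h => same_step id hs h))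
  have hF : Function.Surjective F := by
    intro q
    induction q using Quotient.inductionOn with
    | h x => exact ⟨Quotient.mk _ x, rfl⟩
  unfold Qc
  by_contra hc
  rw [not_lt] at hc
  have hb := hF.bijective_of_nat_card_le hc
  have he : F (Quotient.mk _ x) = F (Quotient.mk _ y) :=
    Quotient.sound (s := SameCycle.setoid τ) (show SameCycle τ x y from hxy)
  exact h (Quotient.exact (s := SameCycle.setoid σ) (hb.1 he))

lemma exists_full {n : ℕ} (k : ℕ) (σ : Equiv.Perm (Fin n)) (h : Qc σ ≤ k) :
    ∃ c : Equiv.Perm (Fin n), (∀ x y, SameCycle c x y) ∧ DD σ c ≤ 2 * k := by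
  induction k generalizing σ with
  | zero =>
    refine ⟨σ, fun x => ?_, by rw [DD_self]⟩
    have h0 : Nat.card (Quotient (SameCycle.setoid σ)) = 0 := by unfold Qc at h; omega
    have := Finite.card_eq_zero_iff.mp h0
    exact (this.false (Quotient.mk _ x)).elim
  | succ k ih =>
    by_cases hf : ∀ x y, SameCycle σ x y
    · exact ⟨σ, hf, by rw [DD_self]; omega⟩
    · push Not at hf
      obtain ⟨x, y, hxy⟩ := hf
      obtain ⟨c, hc, hd⟩ := ih (σ * Equiv.swap x y) (by have := Qc_merge σ x y hxy; omega)
      refine ⟨c, hc, ?_⟩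
      have := DD_triangle σ (σ * Equiv.swap x y) c
      have := DD_swap σ x y
      omega

lemma full_conj {n : ℕ} (hn : 2 ≤ n) (c d : Equiv.Perm (Fin n)) (hc : ∀ x y, SameCycle c x y)
    (hd : ∀ x y, SameCycle d x y) : ∃ g : Equiv.Perm (Fin n), c = g⁻¹ * d * g := by
  have key : ∀ c : Equiv.Perm (Fin n), (∀ x y, SameCycle c x y) → c.IsCycle ∧ c.support = Finset.univ := by
    intro c hc
    have nf : ∀ x, c x ≠ x := by
      intro x hx
      have : Nontrivial (Fin n) := Fin.nontrivial_iff_two_le.mpr hn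
      obtain ⟨y, hy⟩ := exists_ne x
      exact hy ((hc x y).eq_of_left hx).symm
    refine ⟨⟨⟨0, by omega⟩, nf _, fun y _ => hc _ _⟩, ?_⟩
    ext x; simp [nf x]
  have := (key c hc).1.isConj (key d hd).1 (by rw [(key c hc).2, (key d hd).2])
  obtain ⟨g, hg⟩ := isConj_iff.mp this
  refine ⟨g, ?_⟩
  rw [← hg]; group

lemma lis_lip {n : ℕ} (σ τ : Equiv.Perm (Fin n)) : (lis σ : ℝ) ≤ lis τ + DD σ τ := by
  obtain ⟨s, hs, hc⟩ := (le_lis σ _).mp le_rfl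
  have h1 : ((s.filter fun x => σ x = τ x).card : ℝ) ≤ lis τ := by
    rw [le_lis]
    refine ⟨_, ?_, le_rfl⟩
    intro i hi j hj hij
    rw [Finset.mem_filter] at hi hj
    rw [← hi.2, ← hj.2]
    exact hs i hi.1 j hj.1 hij
  have h2 : (s.filter fun x => ¬ σ x = τ x).card ≤ DD σ τ :=
    Finset.card_le_card (Finset.filter_subset_filter _ (Finset.subset_univ s))
  have h3 := Finset.card_filter_add_card_filter_not (s := s) (fun x => σ x = τ x)
  have h4 : (s.card : ℝ) ≤ ((s.filter fun x => σ x = τ x).card : ℝ) + DD σ τ := by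
    exact_mod_cast (by omega : s.card ≤ (s.filter fun x => σ x = τ x).card + DD σ τ)
  linarith

lemma lds_lip {n : ℕ} (σ τ : Equiv.Perm (Fin n)) : (lds σ : ℝ) ≤ lds τ + DD σ τ := by
  rw [← lds_rev, ← lds_rev]
  have := lis_lip (Fin.revPerm * σ) (Fin.revPerm * τ)
  have h : DD (Fin.revPerm * σ) (Fin.revPerm * τ) = DD σ τ := by
    unfold DD; simp [Equiv.Perm.mul_apply]
  rwa [h] at this


lemma permProb_eq {n : ℕ} (p : Equiv.Perm (Fin n) → ℝ) (P : Equiv.Perm (Fin n) → Prop) :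
    permProb p P = ∑ σ, p σ * ind (P σ) := by
  unfold permProb
  refine Finset.sum_congr rfl fun σ _ => ?_
  by_cases h : P σ
  · rw [ind_true h, mul_one, Set.indicator_of_mem (by exact h)]
  · rw [ind_false h, mul_zero, Set.indicator_of_notMem (by exact h)]

lemma conj_avg {n : ℕ} (p : Equiv.Perm (Fin n) → ℝ) (hp : ∀ σ ρ : Equiv.Perm (Fin n), p (ρ⁻¹ * σ * ρ) = p σ)
    (P : Equiv.Perm (Fin n) → Prop) :
    ∑ σ, p σ * ind (P σ) = ∑ σ, p σ * PU n (fun ρ => P (ρ⁻¹ * σ * ρ)) := by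
  unfold PU
  simp only [← mul_div_assoc, Finset.mul_sum]
  rw [← Finset.sum_div, Finset.sum_comm]
  have : ∀ ρ : Equiv.Perm (Fin n), ∑ σ, p σ * ind (P (ρ⁻¹ * σ * ρ)) = ∑ σ, p σ * ind (P σ) := by
    intro ρ
    have h := Equiv.sum_comp (MulAut.conj ρ⁻¹).toEquiv (fun σ => p σ * ind (P σ))
    rw [← h]
    refine Finset.sum_congr rfl fun σ _ => ?_
    have e : (MulAut.conj ρ⁻¹).toEquiv σ = ρ⁻¹ * σ * ρ := by simp [MulAut.conj_apply]
    rw [e, hp]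
  simp only [this]
  have h0 : (n.factorial : ℝ) ≠ 0 := by positivity
  simp only [Finset.sum_const, Finset.card_univ, Fintype.card_perm, Fintype.card_fin, nsmul_eq_mul]
  field_simp

lemma half_small {e : ℝ} (he : 0 < e) : ∀ᶠ n : ℕ in Filter.atTop,
    (n.factorial : ℝ) / 2 ≤ ∑ σ : Equiv.Perm (Fin n), ind ((Qc σ : ℝ) ≤ e * Real.sqrt n) := by
  have h1 := (isLittleO_log_rpow_atTop (r := 1 / 2) (by norm_num)).bound (c := e / 4) (by positivity)
  have h2 := tendsto_natCast_atTop_atTop.eventually h1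
  filter_upwards [h2, sqrt_nat_tendsto.eventually_ge_atTop (4 / e), Filter.eventually_ge_atTop 1] with n hn hn2 hn1
  rw [div_le_iff₀ he] at hn2
  rw [← Real.sqrt_eq_rpow, Real.norm_of_nonneg (Real.sqrt_nonneg _)] at hn
  have hlog : Real.log n ≤ e / 4 * Real.sqrt n := (le_abs_self _).trans hn
  have ht : 0 < Real.sqrt n := Real.sqrt_pos.mpr (by exact_mod_cast hn1)
  set t := Real.sqrt n
  have hH := harmonic_le_one_add_log n
  have hS := sum_Qc n
  have hf : (n.factorial : ℝ) = ∑ σ : Equiv.Perm (Fin n), (1:ℝ) := by simp [Fintype.card_perm]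
  have hM : ∑ σ : Equiv.Perm (Fin n), (1 - ind ((Qc σ : ℝ) ≤ e * t)) ≤ ∑ σ : Equiv.Perm (Fin n), (Qc σ : ℝ) / (e * t) := by
    refine Finset.sum_le_sum fun σ _ => ?_
    have h0 : 0 < e * t := by positivity
    by_cases h : (Qc σ : ℝ) ≤ e * t
    · rw [ind_true h]; rw [sub_self]; positivity
    · rw [ind_false h, sub_zero, le_div_iff₀ h0]; linarith
  rw [Finset.sum_sub_distrib, ← hf, ← Finset.sum_div] at hM
  have h3 : (∑ σ : Equiv.Perm (Fin n), (Qc σ : ℝ)) / (e * t) ≤ n.factorial / 2 := by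
    rw [div_le_iff₀ (by positivity)]
    refine hS.trans ?_
    have : (harmonic n : ℝ) ≤ e * t / 2 := by linarith
    calc (n.factorial : ℝ) * (harmonic n : ℝ) ≤ n.factorial * (e * t / 2) := by gcongr
      _ = _ := by ring
  linarith

lemma A_le {n : ℕ} (hn : 2 ≤ n) (f : Equiv.Perm (Fin n) → ℕ)
    (hf : ∀ σ τ, (f σ : ℝ) ≤ f τ + DD σ τ) {t e : ℝ} (ht : 0 < t) (σ σ' : Equiv.Perm (Fin n))
    (h1 : (Qc σ : ℝ) ≤ e / 4 * t) (h2 : (Qc σ' : ℝ) ≤ e / 4 * t) :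
    PU n (fun ρ => 2 * e < |(f (ρ⁻¹ * σ * ρ) : ℝ) / t - 2|) ≤ PU n (fun ρ => e < |(f (ρ⁻¹ * σ' * ρ) : ℝ) / t - 2|) := by
  obtain ⟨c, hc, dc⟩ := exists_full _ σ le_rfl
  obtain ⟨d, hd, dd⟩ := exists_full _ σ' le_rfl
  obtain ⟨g, rfl⟩ := full_conj hn c d hc hd
  have h3 : PU n (fun ρ => e < |(f (ρ⁻¹ * σ' * ρ) : ℝ) / t - 2|) =
      PU n (fun ρ => e < |(f ((g * ρ)⁻¹ * σ' * (g * ρ)) : ℝ) / t - 2|) := by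
    unfold PU
    congr 1
    exact (Equiv.sum_comp (Equiv.mulLeft g) (fun ρ => ind (e < |(f (ρ⁻¹ * σ' * ρ) : ℝ) / t - 2|))).symm
  rw [h3]
  refine PU_mono fun ρ h => ?_
  have e1 : (g * ρ)⁻¹ * σ' * (g * ρ) = ρ⁻¹ * (g⁻¹ * σ' * g) * ρ := by group
  rw [e1]
  set a := ρ⁻¹ * σ * ρ with ha
  set b := ρ⁻¹ * (g⁻¹ * σ' * g) * ρ with hb
  have hD : DD a b ≤ 2 * Qc σ + 2 * Qc σ' := by
    rw [ha, hb, DD_conj]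
    refine (DD_triangle _ (g⁻¹ * d * g) _).trans ?_
    rw [DD_conj, DD_comm d]
    exact add_le_add dc dd
  have hD' : (DD a b : ℝ) ≤ e * t := by
    have : (DD a b : ℝ) ≤ 2 * Qc σ + 2 * Qc σ' := by exact_mod_cast hD
    linarith
  have k1 := hf a b
  have k2 := hf b a
  rw [DD_comm] at k2
  have k3 : |(f a : ℝ) / t - f b / t| ≤ e := by
    rw [← sub_div, abs_div, abs_of_pos ht, div_le_iff₀ ht, abs_le]
    constructor <;> linarith
  have k4 := abs_sub_le ((f a : ℝ) / t) (f b / t) 2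
  linarith

lemma transfer (f : (n : ℕ) → Equiv.Perm (Fin n) → ℕ)
    (hf : ∀ n, ∀ σ τ, (f n σ : ℝ) ≤ f n τ + DD σ τ)
    (hU : ∀ ε : ℝ, 0 < ε → Filter.Tendsto (fun n : ℕ => PU n (fun σ => ε < |(f n σ : ℝ) / Real.sqrt n - 2|))
      Filter.atTop (nhds 0))
    (p : (n : ℕ) → Equiv.Perm (Fin n) → ℝ)
    (hpos : ∀ n, 1 ≤ n → ∀ σ, 0 ≤ p n σ)
    (hsum : ∀ n, 1 ≤ n → ∑ σ, p n σ = 1)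
    (hinv : ∀ n, 1 ≤ n → ∀ σ ρ : Equiv.Perm (Fin n), p n (ρ⁻¹ * σ * ρ) = p n σ)
    (hcyc : ∀ ε : ℝ, 0 < ε →
      Filter.Tendsto (fun n => permProb (p n) fun σ => ε < (numCycles σ : ℝ) / Real.sqrt n)
        Filter.atTop (nhds 0)) (ε : ℝ) (hε : 0 < ε) :
      Filter.Tendsto (fun n => permProb (p n) fun σ => ε < |(f n σ : ℝ) / Real.sqrt n - 2|)
        Filter.atTop (nhds 0) := by
  set e := ε / 2 with he
  have he0 : 0 < e := by positivity
  have hee : ε = 2 * e := by rw [he]; ring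
  have lim := (hcyc (e / 4) (by positivity)).add ((hU e he0).const_mul 2)
  simp only [mul_zero, add_zero] at lim
  refine tendsto_of_tendsto_of_tendsto_of_le_of_le' tendsto_const_nhds lim ?_ ?_
  · filter_upwards [Filter.eventually_ge_atTop 1] with n hn
    rw [permProb_eq]
    exact Finset.sum_nonneg fun σ _ => mul_nonneg (hpos n hn σ) (ind_nonneg _)
  filter_upwards [Filter.eventually_ge_atTop 2, half_small (e := e / 4) (by positivity)] with n hn hh
  have hn1 : 1 ≤ n := by omega
  have ht : 0 < Real.sqrt n := Real.sqrt_pos.mpr (by exact_mod_cast hn1)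
  set t := Real.sqrt n
  set U := PU n (fun σ => e < |(f n σ : ℝ) / t - 2|) with hUdef
  have hU0 : 0 ≤ U := PU_nonneg _ _
  have hfac : (0:ℝ) < n.factorial := by positivity
  have uni : n.factorial * U = ∑ σ' : Equiv.Perm (Fin n), PU n (fun ρ => e < |(f n (ρ⁻¹ * σ' * ρ) : ℝ) / t - 2|) := by
    have := conj_avg (n := n) (fun _ => 1) (fun _ _ => rfl) (fun σ => e < |(f n σ : ℝ) / t - 2|)
    simp only [one_mul] at this
    rw [← this, hUdef]; unfold PU; field_simp
  have hA : ∀ σ : Equiv.Perm (Fin n), (Qc σ : ℝ) ≤ e / 4 * t →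
      PU n (fun ρ => 2 * e < |(f n (ρ⁻¹ * σ * ρ) : ℝ) / t - 2|) ≤ 2 * U := by
    intro σ hσ
    set A := PU n (fun ρ => 2 * e < |(f n (ρ⁻¹ * σ * ρ) : ℝ) / t - 2|) with hAdef
    have hA0 : 0 ≤ A := PU_nonneg _ _
    have h1 : ∑ σ' : Equiv.Perm (Fin n), ind ((Qc σ' : ℝ) ≤ e / 4 * t) * A ≤ n.factorial * U := by
      rw [uni]
      refine Finset.sum_le_sum fun σ' _ => ?_
      by_cases h : (Qc σ' : ℝ) ≤ e / 4 * t
      · rw [ind_true h, one_mul]; exact A_le hn (f n) (hf n) ht σ σ' hσ h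
      · rw [ind_false h, zero_mul]; exact PU_nonneg _ _
    rw [← Finset.sum_mul] at h1
    have h2 := (mul_le_mul_of_nonneg_right hh hA0).trans h1
    have h3 : (n.factorial : ℝ) * A ≤ n.factorial * (2 * U) := by linarith
    exact le_of_mul_le_mul_left h3 hfac
  rw [hee, permProb_eq, permProb_eq, conj_avg (p n) (hinv n hn1)]
  have hU2 : 2 * U = ∑ σ, p n σ * (2 * U) := by rw [← Finset.sum_mul, hsum n hn1, one_mul]
  rw [hU2, ← Finset.sum_add_distrib]
  refine Finset.sum_le_sum fun σ _ => ?_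
  rw [← mul_add]
  refine mul_le_mul_of_nonneg_left ?_ (hpos n hn1 σ)
  by_cases h : e / 4 < (numCycles σ : ℝ) / t
  · rw [ind_true h]
    have : PU n (fun ρ => 2 * e < |(f n (ρ⁻¹ * σ * ρ) : ℝ) / t - 2|) ≤ 1 := by
      unfold PU
      rw [div_le_one hfac]
      refine (Finset.sum_le_sum fun _ _ => ind_le_one _).trans ?_
      simp [Fintype.card_perm]
    linarith
  · rw [ind_false h, zero_add]
    apply hA
    rw [not_lt, div_le_iff₀ ht] at h
    have : (Qc σ : ℝ) ≤ numCycles σ := by exact_mod_cast Qc_le_numCycles σ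
    linarith

theorem stmt_7 (p : (n : ℕ) → Equiv.Perm (Fin n) → ℝ)
    (hpos : ∀ n, 1 ≤ n → ∀ σ, 0 ≤ p n σ)
    (hsum : ∀ n, 1 ≤ n → ∑ σ, p n σ = 1)
    (hinv : ∀ n, 1 ≤ n → ∀ σ ρ : Equiv.Perm (Fin n), p n (ρ⁻¹ * σ * ρ) = p n σ)
    (hcyc : ∀ ε : ℝ, 0 < ε →
      Filter.Tendsto (fun n => permProb (p n) fun σ => ε < (numCycles σ : ℝ) / Real.sqrt n)
        Filter.atTop (nhds 0)) :
    ∀ ε : ℝ, 0 < ε →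
      Filter.Tendsto (fun n => permProb (p n) fun σ => ε < |(lis σ : ℝ) / Real.sqrt n - 2|)
        Filter.atTop (nhds 0) ∧
      Filter.Tendsto (fun n => permProb (p n) fun σ => ε < |(lds σ : ℝ) / Real.sqrt n - 2|)
        Filter.atTop (nhds 0) := by
  intro ε hε
  exact ⟨transfer (fun n σ => lis σ) (fun n => lis_lip) (fun ε hε => PU_lis hε) p hpos hsum hinv hcyc ε hε,
    transfer (fun n σ => lds σ) (fun n => lds_lip) (fun ε hε => PU_lds hε) p hpos hsum hinv hcyc ε hε⟩
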